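/- arXiv:2408.01513 — 3 statements merged into one kernel-verified Lean document; each statement's English description precedes it below -/
import Mathlib

section
/- As n → ∞, L(1ⁿ) ≍ L[n, n]; that is, there exist constants 0 < a ≤ b such that a · L[n, n] ≤ ln|T(1, 1, …, 1)| ≤ b · L[n, n] for all large n, where the hook sum vector consists of n ones. -/
open Filter

/-- A Kostant picture of height `η`. -/
def IsKostant {w : ℕ} (η : Fin w → ℕ) (c : Fin w → Fin w → ℕ) : Prop :=
  (∀ i j : Fin w, j < i → c i j = 0) ∧
  ∀ m : Fin w, (∑ i : Fin w, ∑ j : Fin w, (if i ≤ m ∧ m ≤ j then c i j else 0)) = η m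

/-- Kostant's partition function. -/
noncomputable def KPF {w : ℕ} (η : Fin w → ℕ) : ℕ :=
  Set.ncard {c : Fin w → Fin w → ℕ | IsKostant η c}

/-- `L[h,w] = ln KPF[(h,…,h)]` for the constant tuple of length `w`. -/
noncomputable def Lbox (h w : ℕ) : ℝ := Real.log (KPF (fun _ : Fin w => h))

/-- A generalized Tesler matrix with hook sum vector `h`. -/
def IsTesler {n : ℕ} (h : Fin n → ℤ) (A : Fin n → Fin n → ℕ) : Prop :=
  (∀ i j : Fin n, j < i → A i j = 0) ∧
  ∀ k : Fin n, (∑ i : Fin n, if k ≤ i then (A k i : ℤ) else 0)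
    - (∑ i : Fin n, if i < k then (A i k : ℤ) else 0) = h k

/-- `L(h) = ln |T(h)|`. -/
noncomputable def LTes {n : ℕ} (h : Fin n → ℤ) : ℝ :=
  Real.log (Set.ncard {A : Fin n → Fin n → ℕ | IsTesler h A})

namespace KostantPicture

open Finset

/-- The height at `m` of a picture on the columns `0, …, w - 1`, indexed by `ℕ`. -/
def height (w : ℕ) (c : ℕ → ℕ → ℕ) (m : ℕ) : ℕ :=
  ∑ i ∈ range (m + 1), ∑ j ∈ Ico m w, c i j

/-- `c` vanishes outside the intervals contained in `[0, w)`. -/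
def IsSupported (w : ℕ) (c : ℕ → ℕ → ℕ) : Prop :=
  ∀ i j, ¬(i ≤ j ∧ j < w) → c i j = 0

/-- The Kostant pictures of width `w` and height `η`, indexed by `ℕ`. -/
def pictures (w : ℕ) (η : ℕ → ℕ) : Set (ℕ → ℕ → ℕ) :=
  {c | IsSupported w c ∧ ∀ m < w, height w c m = η m}

/-- The pictures of width `w` with all heights at most `h`. -/
def subpictures (w h : ℕ) : Set (ℕ → ℕ → ℕ) :=
  {c | IsSupported w c ∧ ∀ m < w, height w c m ≤ h}

/-- Extension by zero of a function on `Fin w × Fin w`. -/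
def extend {w : ℕ} (c : Fin w → Fin w → ℕ) : ℕ → ℕ → ℕ :=
  fun i j => if h : i < w ∧ j < w then c ⟨i, h.1⟩ ⟨j, h.2⟩ else 0

lemma extend_val {w : ℕ} (c : Fin w → Fin w → ℕ) (i j : Fin w) : extend c i j = c i j := by
  simp [extend]

lemma extend_injective {w : ℕ} : Function.Injective (extend (w := w)) := by
  intro c d h
  ext i j
  rw [← extend_val c, ← extend_val d, h]

lemma extend_restrict {w : ℕ} {c : ℕ → ℕ → ℕ} (hc : IsSupported w c) :
    extend (fun i j : Fin w => c i j) = c := by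
  ext i j
  unfold extend
  split_ifs with h
  · rfl
  · exact (hc i j (by omega)).symm

lemma height_add (w : ℕ) (c d : ℕ → ℕ → ℕ) (m : ℕ) :
    height w (c + d) m = height w c m + height w d m := by
  simp [height, sum_add_distrib]

lemma IsSupported.add {w : ℕ} {c d : ℕ → ℕ → ℕ} (hc : IsSupported w c) (hd : IsSupported w d) :
    IsSupported w (c + d) := fun i j h => by simp [hc i j h, hd i j h]

lemma le_height {w : ℕ} {c : ℕ → ℕ → ℕ} {i j : ℕ} (hij : i ≤ j) (hj : j < w) :
    c i j ≤ height w c i :=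
  (single_le_sum (f := fun j => c i j) (fun _ _ => Nat.zero_le _)
    (mem_Ico.2 ⟨hij, hj⟩)).trans
    (single_le_sum (f := fun i' => ∑ j ∈ Ico i w, c i' j) (fun _ _ => Nat.zero_le _)
      (self_mem_range_succ i))

lemma finite_of_le (w M : ℕ) :
    {c : ℕ → ℕ → ℕ | IsSupported w c ∧ ∀ i j, i ≤ j → j < w → c i j ≤ M}.Finite := by
  refine ((Set.finite_Icc (0 : Fin w → Fin w → ℕ) (fun _ _ => M)).image extend).subset ?_
  rintro c ⟨hc, hM⟩
  refine ⟨fun i j => c i j, ⟨fun _ _ => Nat.zero_le _, fun i j => ?_⟩, extend_restrict hc⟩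
  by_cases h : (i : ℕ) ≤ j
  · exact hM i j h j.2
  · simp [hc i j (by omega)]

lemma finite_subpictures (w h : ℕ) : (subpictures w h).Finite :=
  (finite_of_le w h).subset fun _ hc =>
    ⟨hc.1, fun i _ hij hj => (le_height hij hj).trans (hc.2 i (by omega))⟩

lemma finite_pictures (w : ℕ) (η : ℕ → ℕ) : (pictures w η).Finite :=
  (finite_subpictures w (∑ m ∈ range w, η m)).subset fun _ hc =>
    ⟨hc.1, fun m hm => (hc.2 m hm).trans_le
      (single_le_sum (f := η) (fun _ _ => Nat.zero_le _) (mem_range.2 hm))⟩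

/-- The picture consisting of `δ m` copies of the interval `{m}` for each `m < w`. -/
def diag (w : ℕ) (δ : ℕ → ℕ) : ℕ → ℕ → ℕ :=
  fun i j => if i = j ∧ j < w then δ i else 0

lemma isSupported_diag (w : ℕ) (δ : ℕ → ℕ) : IsSupported w (diag w δ) := by
  intro i j h
  simp only [diag]
  rw [if_neg]
  omega

lemma height_diag (w : ℕ) (δ : ℕ → ℕ) {m : ℕ} (hm : m < w) : height w (diag w δ) m = δ m := by
  unfold height
  rw [sum_eq_single m, sum_eq_single m]
  · simp [diag, hm]
  · intro j _ hj
    simp [diag, hj.symm]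
  · intro h
    simp [hm] at h
  · intro i hi him
    refine sum_eq_zero fun j hj => ?_
    simp only [mem_range, mem_Ico] at hi hj
    simp only [diag]
    rw [if_neg]
    omega
  · simp

lemma ncard_pictures_mono {w : ℕ} {η θ : ℕ → ℕ} (h : ∀ m < w, η m ≤ θ m) :
    (pictures w η).ncard ≤ (pictures w θ).ncard := by
  refine Set.ncard_le_ncard_of_injOn (· + diag w (fun m => θ m - η m)) ?_ ?_ (finite_pictures w θ)
  · rintro c ⟨hc, hη⟩
    refine ⟨hc.add (isSupported_diag _ _), fun m hm => ?_⟩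
    have := h m hm
    rw [height_add, height_diag _ _ hm, hη m hm]
    omega
  · intro c _ d _ hcd
    exact add_right_cancel hcd

lemma exists_le_sum_eq {ι : Type*} (s : Finset ι) (f : ι → ℕ) {t : ℕ} (ht : t ≤ ∑ i ∈ s, f i) :
    ∃ r : ι → ℕ, r ≤ f ∧ ∑ i ∈ s, r i = t := by
  classical
  induction t with
  | zero => exact ⟨0, fun _ => Nat.zero_le _, by simp⟩
  | succ t ih =>
    obtain ⟨r, hr, hs⟩ := ih (by omega)
    obtain ⟨i, hi, hlt⟩ : ∃ i ∈ s, r i < f i := exists_lt_of_sum_lt (by omega)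
    refine ⟨r + Pi.single i 1, fun j => ?_, ?_⟩
    · by_cases h : j = i
      · subst h
        simpa using hlt
      · simpa [h] using hr j
    · simp [sum_add_distrib, hs, hi, sum_pi_single']

lemma sum_carry_le {w : ℕ} {c : ℕ → ℕ → ℕ} {k a : ℕ} (h : ∀ m < k, height w c m ≤ a) :
    ∑ i ∈ range k, ∑ j ∈ Ico k w, c i j ≤ a := by
  cases k with
  | zero => simp
  | succ k =>
    refine le_trans ?_ (h k (Nat.lt_succ_self k))
    exact sum_le_sum fun i _ => sum_le_sum_of_subset (Ico_subset_Ico_left (Nat.le_succ k))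

/-- A picture of constant height `a + b` splits into pictures of heights `a` and `b`. -/
lemma exists_add_of_mem_pictures {w a b : ℕ} {c : ℕ → ℕ → ℕ}
    (hc : c ∈ pictures w (fun _ => a + b)) :
    ∃ d ∈ pictures w (fun _ => a), ∃ e ∈ pictures w (fun _ => b), d + e = c := by
  obtain ⟨hs, hh⟩ := hc
  beta_reduce at hh
  have key : ∀ k ≤ w, ∃ d ≤ c, ∀ m < k, height w d m = a := by
    intro k
    induction k with
    | zero => exact fun _ => ⟨0, fun _ _ => Nat.zero_le _, by simp⟩
    | succ k ih =>
      intro hk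
      obtain ⟨d, hd, hda⟩ := ih (by omega)
      have hde : d + (c - d) = c := by
        ext i j
        exact Nat.add_sub_cancel' (hd i j)
      have hdc := sum_carry_le (fun m hm => (hda m hm).le)
      have hec : ∑ i ∈ range k, ∑ j ∈ Ico k w, (c - d) i j ≤ b := by
        refine sum_carry_le fun m hm => ?_
        have h1 := hh m (by omega)
        rw [← hde, height_add, hda m hm] at h1
        omega
      have hsum : ∑ i ∈ range k, ∑ j ∈ Ico k w, c i j
          = ∑ i ∈ range k, ∑ j ∈ Ico k w, d i j + ∑ i ∈ range k, ∑ j ∈ Ico k w, (c - d) i j := by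
        conv_lhs => rw [← hde]
        simp only [Pi.add_apply, sum_add_distrib]
      have hck := hh k (by omega)
      rw [height, sum_range_succ] at hck
      obtain ⟨r, hr, hrs⟩ := exists_le_sum_eq (Ico k w) (c k)
        (t := a - ∑ i ∈ range k, ∑ j ∈ Ico k w, d i j) (by omega)
      refine ⟨Function.update d k r, fun i => ?_, fun m hm => ?_⟩
      · by_cases h : i = k
        · subst h
          simpa using hr
        · simpa [h] using hd i
      · have hlow : ∀ l ≤ k, ∀ m', ∑ i ∈ range l, ∑ j ∈ Ico m' w, Function.update d k r i j
            = ∑ i ∈ range l, ∑ j ∈ Ico m' w, d i j := by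
          intro l hl m'
          refine sum_congr rfl fun i hi => ?_
          rw [Function.update_of_ne]
          have := mem_range.1 hi
          omega
        rcases Nat.lt_succ_iff_lt_or_eq.1 hm with h | rfl
        · rw [height, hlow _ h]
          exact hda m h
        · rw [height, sum_range_succ, hlow _ le_rfl, Function.update_self, hrs]
          omega
  obtain ⟨d, hd, hda⟩ := key w le_rfl
  have hde : d + (c - d) = c := by
    ext i j
    exact Nat.add_sub_cancel' (hd i j)
  refine ⟨d, ⟨fun i j h => ?_, hda⟩, c - d, ⟨fun i j h => ?_, fun m hm => ?_⟩, hde⟩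
  · exact Nat.le_zero.1 ((hd i j).trans (hs i j h).le)
  · simp [hs i j h]
  · have h1 := hh m hm
    rw [← hde, height_add, hda m hm] at h1
    beta_reduce
    omega

lemma ncard_image2_le {α β γ : Type*} (f : α → β → γ) {s : Set α} {t : Set β}
    (hs : s.Finite) (ht : t.Finite) : (Set.image2 f s t).ncard ≤ s.ncard * t.ncard := by
  rw [← Set.image_prod, ← Set.ncard_prod]
  exact Set.ncard_image_le (hs.prod ht)

lemma ncard_pictures_add_le (w a b : ℕ) :
    (pictures w (fun _ => a + b)).ncard
      ≤ (pictures w (fun _ => a)).ncard * (pictures w (fun _ => b)).ncard :=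
  (Set.ncard_le_ncard (fun _ hc => exists_add_of_mem_pictures hc)
    ((finite_pictures _ _).image2 _ (finite_pictures _ _))).trans
    (ncard_image2_le (· + ·) (finite_pictures _ _) (finite_pictures _ _))

lemma ncard_subpictures_le (w h : ℕ) :
    (subpictures w h).ncard ≤ (pictures w (fun _ => h)).ncard * (h + 1) ^ w := by
  let D : (Fin w → Fin (h + 1)) → ℕ → ℕ → ℕ :=
    fun δ => diag w (fun i => if hi : i < w then (δ ⟨i, hi⟩ : ℕ) else 0)
  have hD : (Set.range D).ncard ≤ (h + 1) ^ w := by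
    rw [← Set.image_univ]
    refine (Set.ncard_image_le Set.finite_univ).trans ?_
    simp [Set.ncard_univ]
  have hsub : subpictures w h ⊆
      Set.image2 (fun c d => c - d) (pictures w (fun _ => h)) (Set.range D) := by
    rintro c ⟨hc, hh⟩
    let δ : ℕ → ℕ := fun m => h - height w c m
    have hδ : diag w δ ∈ Set.range D := by
      refine ⟨fun m => ⟨δ m, Nat.lt_succ_of_le (Nat.sub_le _ _)⟩, ?_⟩
      ext i j
      simp only [D, diag]
      split_ifs <;> first | rfl | omega
    refine ⟨c + diag w δ, ⟨hc.add (isSupported_diag _ _), fun m hm => ?_⟩, diag w δ,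
      hδ, ?_⟩
    · have := hh m hm
      rw [height_add, height_diag _ _ hm]
      simp only [δ]
      omega
    · exact add_tsub_cancel_right _ _
  refine (Set.ncard_le_ncard hsub ((finite_pictures _ _).image2 _ (Set.finite_range D))).trans ?_
  exact (ncard_image2_le _ (finite_pictures _ _) (Set.finite_range D)).trans
    (Nat.mul_le_mul_left _ hD)

/-- Translation of a picture to the right by `u` columns. -/
def shift (u : ℕ) (c : ℕ → ℕ → ℕ) : ℕ → ℕ → ℕ :=
  fun i j => if u ≤ i ∧ u ≤ j then c (i - u) (j - u) else 0

lemma shift_add_add (u : ℕ) (c : ℕ → ℕ → ℕ) (i j : ℕ) : shift u c (u + i) (u + j) = c i j := by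
  simp [shift]

lemma shift_injective (u : ℕ) : Function.Injective (shift u) := by
  intro c d h
  ext i j
  rw [← shift_add_add u c, h, shift_add_add]

lemma IsSupported.shift {w : ℕ} {c : ℕ → ℕ → ℕ} (hc : IsSupported w c) (u : ℕ) :
    IsSupported (u + w) (shift u c) := by
  intro i j h
  unfold KostantPicture.shift
  split_ifs with h'
  · exact hc _ _ (by omega)
  · rfl

lemma height_shift_of_lt {u w m : ℕ} (c : ℕ → ℕ → ℕ) (h : m < u) :
    height (u + w) (shift u c) m = 0 := by
  refine sum_eq_zero fun i hi => sum_eq_zero fun j _ => ?_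
  have := mem_range.1 hi
  rw [shift, if_neg]
  omega

lemma height_shift_add (u w m : ℕ) (c : ℕ → ℕ → ℕ) :
    height (u + w) (shift u c) (u + m) = height w c m := by
  unfold height
  rw [add_assoc, sum_range_add, sum_eq_zero, zero_add]
  · refine sum_congr rfl fun i _ => ?_
    rw [add_comm u m, add_comm u w, ← sum_Ico_add (fun j => shift u c (u + i) j) m w u]
    exact sum_congr rfl fun j _ => shift_add_add u c i j
  · intro i hi
    refine sum_eq_zero fun j _ => ?_
    have := mem_range.1 hi
    rw [shift, if_neg]
    omega

lemma ncard_pictures_le_staircase {u w h : ℕ} (hu : h ≤ u + 1) :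
    (pictures w (fun _ => h)).ncard ≤ (pictures (u + w) (fun m => m + 1)).ncard := by
  have h1 : (pictures w (fun _ => h)).ncard
      ≤ (pictures (u + w) (fun m => if m < u then 0 else h)).ncard := by
    refine Set.ncard_le_ncard_of_injOn (shift u) ?_ (shift_injective u).injOn (finite_pictures _ _)
    rintro c ⟨hc, hh⟩
    refine ⟨hc.shift u, fun m hm => ?_⟩
    beta_reduce
    split_ifs with hmu
    · exact height_shift_of_lt c hmu
    · obtain ⟨m, rfl⟩ := Nat.exists_eq_add_of_le (not_lt.1 hmu)
      rw [height_shift_add]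
      exact hh m (by omega)
  refine h1.trans (ncard_pictures_mono fun m _ => ?_)
  split_ifs <;> omega

/-- There are at most `(#s + 1) ^ h` multisets of at most `h` elements of `s`. -/
lemma ncard_multiplicity_le {ι : Type*} (s : Finset ι) (h : ℕ) :
    {f : ι → ℕ | (∀ i ∉ s, f i = 0) ∧ ∑ i ∈ s, f i ≤ h}.Finite ∧
    {f : ι → ℕ | (∀ i ∉ s, f i = 0) ∧ ∑ i ∈ s, f i ≤ h}.ncard ≤ (#s + 1) ^ h := by
  classical
  induction h with
  | zero =>
    have : {f : ι → ℕ | (∀ i ∉ s, f i = 0) ∧ ∑ i ∈ s, f i ≤ 0} ⊆ {0} := by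
      rintro f ⟨h0, hs⟩
      ext i
      by_cases hi : i ∈ s
      · exact sum_eq_zero_iff.1 (Nat.le_zero.1 hs) i hi
      · exact h0 i hi
    exact ⟨(Set.finite_singleton _).subset this,
      (Set.ncard_le_ncard this).trans (by simp)⟩
  | succ h ih =>
    obtain ⟨hfin, hcard⟩ := ih
    let E : Finset (ι → ℕ) := insert 0 (s.image fun i => Pi.single i 1)
    have hE : #E ≤ #s + 1 := (card_insert_le _ _).trans (Nat.succ_le_succ card_image_le)
    have hsub : {f : ι → ℕ | (∀ i ∉ s, f i = 0) ∧ ∑ i ∈ s, f i ≤ h + 1} ⊆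
        Set.image2 (· + ·) {f : ι → ℕ | (∀ i ∉ s, f i = 0) ∧ ∑ i ∈ s, f i ≤ h} (E : Set _) := by
      rintro f ⟨h0, hs⟩
      by_cases hz : ∑ i ∈ s, f i = 0
      · exact ⟨f, ⟨h0, by omega⟩, 0, by simp [E], by simp⟩
      · obtain ⟨i, hi, hfi⟩ := exists_ne_zero_of_sum_ne_zero hz
        have hle : (Pi.single i 1 : ι → ℕ) ≤ f := by
          intro j
          by_cases hj : j = i
          · subst hj
            simpa using Nat.one_le_iff_ne_zero.2 hfi
          · simp [hj]
        have hf : f - (Pi.single i 1 : ι → ℕ) + Pi.single i 1 = f := tsub_add_cancel_of_le hle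
        refine ⟨f - Pi.single i 1, ⟨fun j hj => by simp [h0 j hj], ?_⟩, Pi.single i 1, ?_, hf⟩
        · have hsum : ∑ j ∈ s, (f - (Pi.single i 1 : ι → ℕ) + Pi.single i 1 : ι → ℕ) j
              = ∑ j ∈ s, (f - Pi.single i 1 : ι → ℕ) j + 1 := by
            simp only [Pi.add_apply, sum_add_distrib, sum_pi_single', hi, if_true]
          rw [hf] at hsum
          omega
        · simp only [E, coe_insert, coe_image]
          exact Or.inr ⟨i, hi, rfl⟩
    have hfin' := hfin.image2 (· + ·) E.finite_toSet
    refine ⟨hfin'.subset hsub, (Set.ncard_le_ncard hsub hfin').trans ?_⟩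
    refine (ncard_image2_le _ hfin E.finite_toSet).trans ?_
    rw [Set.ncard_coe_finset, pow_succ]
    exact Nat.mul_le_mul hcard hE

/-- Pictures consisting of at most `h` intervals `[i, j]` with `i < u ≤ j < w`. -/
def crossings (u w h : ℕ) : Set (ℕ → ℕ → ℕ) :=
  {c | (∀ i j, ¬(i < u ∧ u ≤ j ∧ j < w) → c i j = 0) ∧
    ∑ i ∈ range u, ∑ j ∈ Ico u w, c i j ≤ h}

lemma crossings_subset_image (u w h : ℕ) :
    crossings u w h ⊆ (fun f : ℕ × ℕ → ℕ => fun i j => f (i, j)) ''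
      {f | (∀ p ∉ range u ×ˢ Ico u w, f p = 0) ∧ ∑ p ∈ range u ×ˢ Ico u w, f p ≤ h} := by
  rintro c ⟨h0, hs⟩
  refine ⟨fun p => c p.1 p.2, ⟨fun p hp => h0 _ _ fun h => hp ?_, ?_⟩, rfl⟩
  · simpa using h
  · rwa [sum_product]

lemma finite_crossings (u w h : ℕ) : (crossings u w h).Finite :=
  ((ncard_multiplicity_le _ h).1.image _).subset (crossings_subset_image u w h)

lemma ncard_crossings_le {u w : ℕ} (huw : u ≤ w) (h : ℕ) :
    (crossings u w h).ncard ≤ (w + 1) ^ (2 * h) := by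
  obtain ⟨hfin, hcard⟩ := ncard_multiplicity_le (range u ×ˢ Ico u w) h
  refine (Set.ncard_le_ncard (crossings_subset_image u w h) (hfin.image _)).trans ?_
  refine (Set.ncard_image_le hfin).trans (hcard.trans ?_)
  rw [pow_mul]
  refine Nat.pow_le_pow_left ?_ h
  rw [card_product, card_range, Nat.card_Ico]
  have : u * (w - u) ≤ w * w := Nat.mul_le_mul huw (Nat.sub_le _ _)
  nlinarith

lemma pictures_subset_sum (u v h : ℕ) (hv : 0 < v) :
    pictures (u + v) (fun _ => h) ⊆ Set.image2 (· + ·)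
      (Set.image2 (· + ·) (subpictures u h) (shift u '' subpictures v h))
      (crossings u (u + v) h) := by
  rintro c ⟨hc, hh⟩
  beta_reduce at hh
  refine ⟨_, ⟨fun i j => if j < u then c i j else 0, ⟨?_, ?_⟩, _,
    ⟨fun i j => c (u + i) (u + j), ⟨?_, ?_⟩, rfl⟩, rfl⟩,
    fun i j => if i < u ∧ u ≤ j then c i j else 0, ⟨?_, ?_⟩, ?_⟩
  · intro i j hij
    dsimp only
    split_ifs
    · exact hc _ _ (by omega)
    · rfl
  · intro m hm
    rw [← hh m (by omega)]
    refine sum_le_sum fun i _ => ?_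
    refine (sum_le_sum fun j _ => ?_).trans
      (sum_le_sum_of_subset (Ico_subset_Ico_right (Nat.le_add_right u v)))
    beta_reduce
    split_ifs <;> simp
  · intro i j hij
    exact hc _ _ (by omega)
  · intro m hm
    rw [← hh (u + m) (by omega), height, height, add_assoc, sum_range_add _ u]
    refine le_trans (le_of_eq ?_) (Nat.le_add_left _ _)
    rw [add_comm u m, add_comm u v]
    exact sum_congr rfl fun i _ => sum_Ico_add (fun j => c (u + i) j) m v u
  · intro i j hij
    dsimp only
    split_ifs
    · exact hc _ _ (by omega)
    · rfl
  · rw [← hh u (by omega), height, sum_range_succ]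
    refine le_trans (sum_le_sum fun i _ => sum_le_sum fun j _ => ?_) (Nat.le_add_right _ _)
    beta_reduce
    split_ifs <;> simp
  · ext i j
    simp only [Pi.add_apply, shift]
    have h0 := hc i j
    by_cases h1 : j < u <;> by_cases h2 : i < u <;> simp only [h1, h2] <;>
      simp <;> grind

lemma ncard_pictures_split_le {u v : ℕ} (hv : 0 < v) (h : ℕ) :
    (pictures (u + v) (fun _ => h)).ncard ≤
      (subpictures u h).ncard * (subpictures v h).ncard * (u + v + 1) ^ (2 * h) := by
  have h1 := finite_subpictures u h
  have h2 := (finite_subpictures v h).image (shift u)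
  have h3 := finite_crossings u (u + v) h
  refine (Set.ncard_le_ncard (pictures_subset_sum u v h hv) ((h1.image2 _ h2).image2 _ h3)).trans ?_
  refine (ncard_image2_le _ (h1.image2 _ h2) h3).trans ?_
  refine Nat.mul_le_mul ((ncard_image2_le _ h1 h2).trans ?_)
    (ncard_crossings_le (Nat.le_add_right u v) h)
  exact Nat.mul_le_mul_left _ (Set.ncard_image_le (finite_subpictures v h))

lemma ncard_subpictures_le_staircase {u w h : ℕ} (hu : h ≤ 2 * (u + 1)) :
    (subpictures w h).ncard ≤ (pictures (u + w) (fun m => m + 1)).ncard ^ 2 * (h + 1) ^ w := by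
  refine (ncard_subpictures_le w h).trans (Nat.mul_le_mul_right _ ?_)
  calc (pictures w (fun _ => h)).ncard
      ≤ (pictures w (fun _ => (u + 1) + (u + 1))).ncard :=
        ncard_pictures_mono fun _ _ => by omega
    _ ≤ _ := ncard_pictures_add_le _ _ _
    _ ≤ _ := by
      rw [sq]
      exact Nat.mul_le_mul (ncard_pictures_le_staircase le_rfl) (ncard_pictures_le_staircase le_rfl)

lemma ncard_pictures_le_staircase_pow {n : ℕ} (hn : 0 < n) :
    (pictures n (fun _ => n)).ncard
      ≤ (pictures n (fun m => m + 1)).ncard ^ 4 * (n + 1) ^ (3 * n) := by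
  obtain ⟨u, v, rfl, hv, h1, h2⟩ : ∃ u v, n = u + v ∧ 0 < v ∧ u ≤ v + 1 ∧ v ≤ u + 1 :=
    ⟨n / 2, n - n / 2, by omega, by omega, by omega, by omega⟩
  have hl := ncard_subpictures_le_staircase (u := v) (w := u) (h := u + v) (by omega)
  have hr := ncard_subpictures_le_staircase (u := u) (w := v) (h := u + v) (by omega)
  rw [add_comm v u] at hl
  refine (ncard_pictures_split_le hv (u + v)).trans ?_
  refine (Nat.mul_le_mul_right _ (Nat.mul_le_mul hl hr)).trans (le_of_eq ?_)
  ring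

lemma pow_self_le_ncard_staircase {k n : ℕ} (hkn : 3 * k ≤ n) :
    k ^ k ≤ (pictures n (fun m => m + 1)).ncard := by
  let E : (Fin k → Fin k) → ℕ → ℕ → ℕ := fun f i j =>
    if h : k ≤ i ∧ i - k < k then (if j = 2 * k + f ⟨i - k, h.2⟩ then 1 else 0) else 0
  have hE : ∀ f i j, ¬(k ≤ i ∧ i < 2 * k ∧ 2 * k ≤ j ∧ j < 3 * k) → E f i j = 0 := by
    intro f i j h
    simp only [E]
    split_ifs with h1 h2
    · have := (f ⟨i - k, h1.2⟩).2
      omega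
    · rfl
    · rfl
  have hrow : ∀ f i m, ∑ j ∈ Ico m n, E f i j ≤ if k ≤ i ∧ i < 2 * k then 1 else 0 := by
    intro f i m
    by_cases h : k ≤ i ∧ i < 2 * k
    · have h' : k ≤ i ∧ i - k < k := by omega
      simp only [E, h', h, and_self, dif_pos, if_true, sum_ite_eq']
      split_ifs <;> simp
    · rw [if_neg h, sum_eq_zero]
      intro j _
      exact hE f i j (by omega)
  have hheight : ∀ f m, height n (E f) m ≤ m + 1 := by
    intro f m
    refine (sum_le_card_nsmul (range (m + 1)) _ 1 fun i _ => (hrow f i m).trans ?_).trans ?_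
    · split_ifs <;> simp
    · simp
  have hmain : (Set.univ : Set (Fin k → Fin k)).ncard ≤ (pictures n (fun m => m + 1)).ncard := by
    refine Set.ncard_le_ncard_of_injOn
      (fun f => E f + diag n (fun m => m + 1 - height n (E f) m)) ?_ ?_ (finite_pictures _ _)
    · intro f _
      refine ⟨IsSupported.add (fun i j h => hE f i j (by omega)) (isSupported_diag _ _),
        fun m hm => ?_⟩
      rw [height_add, height_diag _ _ hm]
      exact Nat.add_sub_cancel' (hheight f m)
    · intro f _ g _ hfg
      ext i
      have h1 := congrFun (congrFun hfg (k + i)) (2 * k + f i)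
      have h2 : k + (i : ℕ) ≠ 2 * k + f i := by omega
      simp only [Pi.add_apply, diag, h2, false_and, if_false, add_zero, E] at h1
      simp at h1
      omega
  simpa [Set.ncard_univ] using hmain

lemma succ_pow_self_le_staircase {n : ℕ} (hn : 9 ≤ n) :
    (n + 1) ^ n ≤ (pictures n (fun m => m + 1)).ncard ^ 12 := by
  obtain ⟨k, hk, h1, h2⟩ : ∃ k, 3 ≤ k ∧ 3 * k ≤ n ∧ n ≤ 3 * k + 2 :=
    ⟨n / 3, by omega, by omega, by omega⟩
  have h3 : n + 1 ≤ k ^ 3 := by 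
    nlinarith [Nat.mul_le_mul hk hk, Nat.mul_le_mul_right k (Nat.mul_le_mul hk hk)]
  calc (n + 1) ^ n ≤ (k ^ 3) ^ n := Nat.pow_le_pow_left h3 n
    _ ≤ (k ^ 3) ^ (4 * k) := Nat.pow_le_pow_right (by positivity) (by omega)
    _ = (k ^ k) ^ 12 := by ring
    _ ≤ _ := Nat.pow_le_pow_left (pow_self_le_ncard_staircase h1) 12

lemma ncard_pictures_le_staircase_pow_const {n : ℕ} (hn : 9 ≤ n) :
    (pictures n (fun _ => n)).ncard ≤ (pictures n (fun m => m + 1)).ncard ^ 40 := by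
  refine (ncard_pictures_le_staircase_pow (by omega)).trans ?_
  calc _ = (pictures n (fun m => m + 1)).ncard ^ 4 * ((n + 1) ^ n) ^ 3 := by
        rw [← pow_mul, mul_comm n 3]
    _ ≤ (pictures n (fun m => m + 1)).ncard ^ 4
        * ((pictures n (fun m => m + 1)).ncard ^ 12) ^ 3 :=
      Nat.mul_le_mul_left _ (Nat.pow_le_pow_left (succ_pow_self_le_staircase hn) 3)
    _ = _ := by ring

lemma height_extend {w : ℕ} (c : Fin w → Fin w → ℕ) (m : Fin w) :
    height w (extend c) m = ∑ i : Fin w, ∑ j : Fin w, if i ≤ m ∧ m ≤ j then c i j else 0 := by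
  have h1 : ∑ i : Fin w, ∑ j : Fin w, (if i ≤ m ∧ m ≤ j then c i j else 0)
      = ∑ i ∈ range w, ∑ j ∈ range w, if i ≤ (m : ℕ) ∧ (m : ℕ) ≤ j then extend c i j else 0 := by
    rw [← Fin.sum_univ_eq_sum_range
      (fun i => ∑ j ∈ range w, if i ≤ (m : ℕ) ∧ (m : ℕ) ≤ j then extend c i j else 0)]
    refine sum_congr rfl fun i _ => ?_
    rw [← Fin.sum_univ_eq_sum_range (fun j => if (i : ℕ) ≤ m ∧ (m : ℕ) ≤ j then extend c i j else 0)]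
    simp [extend_val]
  rw [h1, height]
  have h2 : range ((m : ℕ) + 1) = {i ∈ range w | i ≤ (m : ℕ)} := by
    ext i
    simp only [mem_range, mem_filter]
    omega
  have h3 : Ico (m : ℕ) w = {j ∈ range w | (m : ℕ) ≤ j} := by
    ext i
    simp only [mem_range, mem_filter, mem_Ico]
    omega
  rw [h2, h3, sum_filter]
  refine sum_congr rfl fun i _ => ?_
  rw [sum_filter]
  split_ifs with h <;> simp [h]

lemma KPF_eq_ncard_pictures {w : ℕ} (η : ℕ → ℕ) :
    KPF (fun i : Fin w => η i) = (pictures w η).ncard := by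
  rw [KPF, ← Set.ncard_image_of_injective _ extend_injective]
  congr 1
  ext c
  constructor
  · rintro ⟨c, ⟨h0, hh⟩, rfl⟩
    refine ⟨fun i j h => ?_, fun m hm => ?_⟩
    · unfold extend
      split_ifs with h'
      · exact h0 _ _ (Fin.mk_lt_mk.2 (by omega))
      · rfl
    · exact (height_extend c ⟨m, hm⟩).trans (hh ⟨m, hm⟩)
  · rintro ⟨h0, hh⟩
    refine ⟨fun i j => c i j, ⟨fun i j h => h0 _ _ ?_, fun m => ?_⟩, extend_restrict h0⟩
    · have : (j : ℕ) < i := h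
      omega
    · rw [← height_extend, extend_restrict h0]
      exact hh m m.2

/-- The picture of a Tesler matrix: entry `(i, j)` with `i < j` becomes the interval `[i, j - 1]`,
and entry `(i, i)` becomes `[i, n - 1]`. -/
def ofTesler (n : ℕ) (a : ℕ → ℕ → ℕ) : ℕ → ℕ → ℕ :=
  fun i j => if i ≤ j ∧ j < n then (if j + 1 < n then a i (j + 1) else a i i) else 0

lemma ofTesler_injOn (n : ℕ) : Set.InjOn (ofTesler n) {a | IsSupported n a} := by
  intro a ha b hb hab
  ext i j
  by_cases h : i ≤ j ∧ j < n
  · rcases h.1.eq_or_lt with rfl | hij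
    · have := congrFun (congrFun hab i) (n - 1)
      simpa [ofTesler, show i ≤ n - 1 by omega, show n - 1 < n by omega,
        show ¬ n - 1 + 1 < n by omega] using this
    · have := congrFun (congrFun hab i) (j - 1)
      simpa [ofTesler, show i ≤ j - 1 by omega, show j - 1 < n by omega,
        show j - 1 + 1 = j by omega, h.2] using this
  · rw [ha i j h, hb i j h]

lemma exists_ofTesler_eq {n : ℕ} {c : ℕ → ℕ → ℕ} (hc : IsSupported n c) :
    ∃ a, IsSupported n a ∧ ofTesler n a = c := by
  refine ⟨fun i j => if i ≤ j ∧ j < n then (if i = j then c i (n - 1) else c i (j - 1)) else 0,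
    fun i j h => if_neg h, ?_⟩
  ext i j
  by_cases h : i ≤ j ∧ j < n
  · simp only [ofTesler, h, and_self, if_true]
    by_cases h1 : j + 1 < n
    · simp [h1, show i ≤ j + 1 by omega, show i ≠ j + 1 by omega]
    · have h2 : j = n - 1 := by omega
      rw [if_neg h1, if_pos ⟨le_rfl, by omega⟩, ← h2]
  · rw [hc i j h, ofTesler, if_neg h]

lemma sum_row_ofTesler {n k : ℕ} (hk : k < n) (a : ℕ → ℕ → ℕ) :
    ∑ j ∈ Ico k n, ofTesler n a k j = ∑ j ∈ Ico k n, a k j := by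
  obtain ⟨p, rfl⟩ : ∃ p, n = p + 1 := ⟨n - 1, by omega⟩
  rw [sum_Ico_succ_top (by omega), sum_eq_sum_Ico_succ_bot hk, add_comm (a k k),
    ← sum_Ico_add' (fun j => a k j) k p 1]
  congr 1
  · refine sum_congr rfl fun j hj => ?_
    have := mem_Ico.1 hj
    simp [ofTesler, this.1, show j < p + 1 by omega, this.2]
  · simp [ofTesler, show k ≤ p by omega]

lemma sum_col_ofTesler {n m : ℕ} (hm : m + 1 < n) (a : ℕ → ℕ → ℕ) :
    ∑ i ∈ range (m + 1), ofTesler n a i m = ∑ i ∈ range (m + 1), a i (m + 1) := by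
  refine sum_congr rfl fun i hi => ?_
  have := mem_range.1 hi
  simp [ofTesler, show i ≤ m by omega, show m < n by omega, hm]

lemma height_succ {n m : ℕ} (hm : m < n) (c : ℕ → ℕ → ℕ) :
    height n c (m + 1) + ∑ i ∈ range (m + 1), c i m
      = height n c m + ∑ j ∈ Ico (m + 1) n, c (m + 1) j := by
  unfold height
  rw [sum_range_succ, add_right_comm, ← sum_add_distrib]
  congr 1
  refine sum_congr rfl fun i _ => ?_
  rw [sum_eq_sum_Ico_succ_bot hm, add_comm]

/-- The hook sums of `a` are all one iff the picture of `a` has height `(1, 2, …, n)`. -/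
lemma height_ofTesler_iff (n : ℕ) (a : ℕ → ℕ → ℕ) :
    (∀ m < n, height n (ofTesler n a) m = m + 1) ↔
      ∀ k < n, ∑ j ∈ Ico k n, a k j = ∑ i ∈ range k, a i k + 1 := by
  have hzero : 0 < n → height n (ofTesler n a) 0 = ∑ j ∈ Ico 0 n, a 0 j := by
    intro h
    rw [height, zero_add, sum_range_one, sum_row_ofTesler h]
  have hsucc : ∀ m, m + 1 < n → height n (ofTesler n a) (m + 1) + ∑ i ∈ range (m + 1), a i (m + 1)
      = height n (ofTesler n a) m + ∑ j ∈ Ico (m + 1) n, a (m + 1) j := by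
    intro m hm
    rw [← sum_row_ofTesler hm, ← sum_col_ofTesler hm, height_succ (by omega)]
  constructor
  · intro h k hk
    cases k with
    | zero => rw [← hzero hk, h 0 hk, range_zero, sum_empty]
    | succ k =>
      have h1 := hsucc k hk
      rw [h _ hk, h k (by omega)] at h1
      omega
  · intro h m
    induction m with
    | zero => exact fun hm => by rw [hzero hm, h 0 hm, range_zero, sum_empty]
    | succ m ih =>
      intro hm
      have h1 := hsucc m hm
      rw [ih (by omega), h _ hm] at h1
      omega

lemma hook_iff {n : ℕ} (A : Fin n → Fin n → ℕ) (k : Fin n) :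
    (∑ i : Fin n, if k ≤ i then (A k i : ℤ) else 0)
      - (∑ i : Fin n, if i < k then (A i k : ℤ) else 0) = 1 ↔
      ∑ j ∈ Ico (k : ℕ) n, extend A k j = ∑ i ∈ range k, extend A i k + 1 := by
  have h1 : (∑ i : Fin n, if k ≤ i then (A k i : ℤ) else 0)
      = ((∑ j ∈ Ico (k : ℕ) n, extend A k j : ℕ) : ℤ) := by
    have : Ico (k : ℕ) n = {j ∈ range n | (k : ℕ) ≤ j} := by
      ext i
      simp only [mem_range, mem_filter, mem_Ico]
      omega
    rw [this, sum_filter, ← Fin.sum_univ_eq_sum_range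
      (fun j => if (k : ℕ) ≤ j then extend A k j else 0)]
    push_cast
    simp [extend_val]
  have h2 : (∑ i : Fin n, if i < k then (A i k : ℤ) else 0)
      = ((∑ i ∈ range k, extend A i k : ℕ) : ℤ) := by
    have : range (k : ℕ) = {j ∈ range n | j < (k : ℕ)} := by
      ext i
      simp only [mem_range, mem_filter]
      omega
    rw [this, sum_filter, ← Fin.sum_univ_eq_sum_range
      (fun j => if j < (k : ℕ) then extend A j k else 0)]
    push_cast
    simp [extend_val]
  rw [h1, h2]
  omega

lemma ncard_isTesler_one (n : ℕ) :
    {A : Fin n → Fin n → ℕ | IsTesler (fun _ => (1 : ℤ)) A}.ncard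
      = (pictures n (fun m => m + 1)).ncard := by
  have hsupp : ∀ A : Fin n → Fin n → ℕ, (∀ i j : Fin n, j < i → A i j = 0) →
      IsSupported n (extend A) := by
    intro A hA i j h
    unfold extend
    split_ifs with h'
    · exact hA _ _ (Fin.mk_lt_mk.2 (by omega))
    · rfl
  have hinj : Set.InjOn (fun A : Fin n → Fin n → ℕ => ofTesler n (extend A))
      {A | IsTesler (fun _ => (1 : ℤ)) A} := fun A hA B hB hAB =>
    extend_injective (ofTesler_injOn n (hsupp A hA.1) (hsupp B hB.1) hAB)
  rw [← hinj.ncard_image]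
  congr 1
  ext c
  constructor
  · rintro ⟨A, ⟨hA, hk⟩, rfl⟩
    refine ⟨fun i j h => if_neg h, (height_ofTesler_iff n _).2 fun k hkn => ?_⟩
    exact (hook_iff A ⟨k, hkn⟩).1 (hk ⟨k, hkn⟩)
  · rintro ⟨hc, hh⟩
    obtain ⟨a, ha, rfl⟩ := exists_ofTesler_eq hc
    have hext := extend_restrict ha
    refine ⟨fun i j => a i j, ⟨fun i j h => ha _ _ ?_, fun k =>
        (hook_iff (fun i j : Fin n => a i j) k).2 ?_⟩, ?_⟩
    · have : (j : ℕ) < i := h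
      omega
    · rw [hext]
      exact (height_ofTesler_iff n a).1 hh k k.2
    · simp only [hext]

lemma ncard_pictures_pos (w : ℕ) (η : ℕ → ℕ) : 0 < (pictures w η).ncard :=
  (Set.ncard_pos (finite_pictures w η)).2
    ⟨diag w η, isSupported_diag w η, fun _ hm => height_diag w η hm⟩

end KostantPicture

open KostantPicture

/-- `L(1ⁿ) ≍ L[n,n]`. -/
theorem L_ones_asymp_Lbox :
    ∃ a b : ℝ, 0 < a ∧ a ≤ b ∧ ∀ᶠ n : ℕ in atTop,
      a * Lbox n n ≤ LTes (fun _ : Fin n => (1 : ℤ)) ∧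
      LTes (fun _ : Fin n => (1 : ℤ)) ≤ b * Lbox n n := by
  refine ⟨1 / 40, 1, by norm_num, by norm_num, ?_⟩
  filter_upwards [eventually_ge_atTop 9] with n hn
  have hT := ncard_pictures_pos n (fun m => m + 1)
  have hP := ncard_pictures_pos n (fun _ => n)
  rw [Lbox, LTes, KPF_eq_ncard_pictures (fun _ => n), ncard_isTesler_one]
  constructor
  · have h : Real.log ((pictures n (fun _ => n)).ncard : ℝ)
        ≤ Real.log (((pictures n (fun m => m + 1)).ncard : ℝ) ^ 40) :=
      Real.log_le_log (by exact_mod_cast hP)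
        (by exact_mod_cast ncard_pictures_le_staircase_pow_const hn)
    rw [Real.log_pow] at h
    push_cast at h
    linarith
  · rw [one_mul]
    refine Real.log_le_log (by exact_mod_cast hT) ?_
    exact_mod_cast ncard_pictures_mono fun m hm => hm
end

section
/- Let h, w, w₀ : ℤ⁺ → ℤ⁺ with w₀ ≻ w ≻ 1 and with w(n) dividing w₀(n) for all n. Then L[h, w₀] ≾ (w₀/w)·L[h,w] + L^{w²}[h, w₀/w]; that is, limsup of L[h,w₀] / ((w₀/w)·L[h,w] + L^{w²}[h, w₀/w]) is at most 1. -/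
open Filter

/-- `T^k[η]`: the maximal number of `k`-colorings of a Kostant picture of height `η`,
where a picture `c` has `∏_{i ≤ j} C(c i j + k - 1, k - 1)` colorings. -/
noncomputable def Tcol {w : ℕ} (k : ℕ) (η : Fin w → ℕ) : ℕ :=
  sSup ((fun c : Fin w → Fin w → ℕ =>
      ∏ i : Fin w, ∏ j : Fin w,
        (if i ≤ j then Nat.choose (c i j + k - 1) (k - 1) else 1)) ''
    {c : Fin w → Fin w → ℕ | IsKostant η c})

/-- `L^k[h,w] = ln T^k[(h,…,h)]` for the constant tuple of length `w`. -/
noncomputable def Lcol (k h w : ℕ) : ℝ := Real.log (Tcol k (fun _ : Fin w => h))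

/-- The number of loops of the picture `c` that pass over the vertex `m`. -/
def coverage {w : ℕ} (c : Fin w → Fin w → ℕ) (m : Fin w) : ℕ :=
  ∑ i : Fin w, ∑ j : Fin w, (if i ≤ m ∧ m ≤ j then c i j else 0)

lemma coverage_add_diag {w : ℕ} (d : Fin w → Fin w → ℕ) (e : Fin w → ℕ) (m : Fin w) :
    coverage (fun i j => d i j + if i = j then e i else 0) m = coverage d m + e m := by
  have key : ∀ i j : Fin w, (if i ≤ m ∧ m ≤ j then d i j + (if i = j then e i else 0) else 0) =
      (if i ≤ m ∧ m ≤ j then d i j else 0) + (if i = m then (if j = m then e m else 0) else 0) := by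
    intro i j
    by_cases h1 : i ≤ m ∧ m ≤ j
    · by_cases h2 : i = j
      · subst h2
        have : i = m := le_antisymm h1.1 h1.2
        subst this
        simp
      · rw [if_pos h1, if_pos h1, if_neg h2]
        by_cases h3 : i = m
        · rw [if_pos h3, if_neg (fun h4 => h2 (h3.trans h4.symm))]
        · rw [if_neg h3]
    · rw [if_neg h1, if_neg h1]
      by_cases h3 : i = m
      · rw [if_pos h3, if_neg]
        rintro rfl
        exact h1 ⟨h3.le, le_rfl⟩
      · rw [if_neg h3]
  simp only [coverage, key, Finset.sum_add_distrib]
  simp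

lemma le_coverage {w : ℕ} (c : Fin w → Fin w → ℕ) {i j m : Fin w} (hi : i ≤ m) (hj : m ≤ j) :
    c i j ≤ coverage c m := by
  calc c i j = if i ≤ m ∧ m ≤ j then c i j else 0 := by rw [if_pos ⟨hi, hj⟩]
    _ ≤ ∑ j : Fin w, (if i ≤ m ∧ m ≤ j then c i j else 0) :=
      Finset.single_le_sum (f := fun j => if i ≤ m ∧ m ≤ j then c i j else 0)
        (fun _ _ => Nat.zero_le _) (Finset.mem_univ j)
    _ ≤ _ := Finset.single_le_sum
        (f := fun i => ∑ j : Fin w, (if i ≤ m ∧ m ≤ j then c i j else 0))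
        (fun _ _ => Nat.zero_le _) (Finset.mem_univ i)

/-- The picture of height `η` obtained from a smaller picture by adding one-vertex loops. -/
def fillDiag {w : ℕ} (η : Fin w → ℕ) (d : Fin w → Fin w → ℕ) : Fin w → Fin w → ℕ :=
  fun i j => d i j + if i = j then η i - coverage d i else 0

lemma isKostant_fillDiag {w : ℕ} {η : Fin w → ℕ} {d : Fin w → Fin w → ℕ}
    (htri : ∀ i j : Fin w, j < i → d i j = 0) (hle : ∀ m, coverage d m ≤ η m) :
    IsKostant η (fillDiag η d) := by
  refine ⟨fun i j hij => by simp [fillDiag, htri i j hij, hij.ne'], fun m => ?_⟩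
  have := coverage_add_diag d (fun i => η i - coverage d i) m
  have h2 := hle m
  change coverage (fillDiag η d) m = η m
  rw [show coverage (fillDiag η d) m = _ from this]
  omega

lemma le_fillDiag {w : ℕ} (η : Fin w → ℕ) (d : Fin w → Fin w → ℕ) (i j : Fin w) :
    d i j ≤ fillDiag η d i j := Nat.le_add_right _ _

lemma fillDiag_of_ne {w : ℕ} (η : Fin w → ℕ) (d : Fin w → Fin w → ℕ) {i j : Fin w} (h : i ≠ j) :
    fillDiag η d i j = d i j := by simp [fillDiag, h]

/-- A picture of given height is determined by its loops on at least two vertices. -/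
lemma IsKostant.eq_of_off_diag {w : ℕ} {η : Fin w → ℕ} {c c' : Fin w → Fin w → ℕ}
    (hc : IsKostant η c) (hc' : IsKostant η c') (h : ∀ i j, i ≠ j → c i j = c' i j) :
    c = c' := by
  have key : ∀ c : Fin w → Fin w → ℕ, ∀ m, coverage c m =
      coverage (fun i j => if i = j then 0 else c i j) m + c m m := by
    intro c m
    rw [← coverage_add_diag _ (fun i => c i i)]
    congr 1
    funext i j
    by_cases hij : i = j
    · subst hij; simp
    · simp [hij]
  have hoff : (fun i j => if i = j then 0 else c i j) = (fun i j => if i = j then 0 else c' i j) := by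
    funext i j
    by_cases hij : i = j
    · simp [hij]
    · simp [hij, h i j hij]
  funext i j
  by_cases hij : i = j
  · subst hij
    have h1 := key c i
    have h2 := key c' i
    have h3 : coverage c i = η i := hc.2 i
    have h4 : coverage c' i = η i := hc'.2 i
    rw [hoff] at h1
    omega
  · exact h i j hij

open Classical in
/-- The pictures of width `w` and height at most `h`. -/
noncomputable def subPictures (h w : ℕ) : Finset (Fin w → Fin w → ℕ) :=
  (Fintype.piFinset fun i => Fintype.piFinset fun j =>
    if i ≤ j then Finset.range (h + 1) else {0}).filter fun c => ∀ m, coverage c m ≤ h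

lemma mem_subPictures {h w : ℕ} {c : Fin w → Fin w → ℕ} :
    c ∈ subPictures h w ↔ (∀ i j : Fin w, j < i → c i j = 0) ∧ ∀ m, coverage c m ≤ h := by
  simp only [subPictures, Finset.mem_filter, Fintype.mem_piFinset]
  constructor
  · rintro ⟨h1, h2⟩
    refine ⟨fun i j hij => ?_, h2⟩
    simpa [not_le.mpr hij] using h1 i j
  · rintro ⟨h1, h2⟩
    refine ⟨fun i j => ?_, h2⟩
    by_cases hij : i ≤ j
    · simp only [hij, if_true, Finset.mem_range]
      have := le_coverage c le_rfl hij
      have := h2 i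
      omega
    · simpa [hij] using h1 i j (not_le.mp hij)

open Classical in
/-- The pictures of width `w` and height exactly `h`. -/
noncomputable def pictures (h w : ℕ) : Finset (Fin w → Fin w → ℕ) :=
  (subPictures h w).filter fun c => IsKostant (fun _ => h) c

lemma mem_pictures {h w : ℕ} {c : Fin w → Fin w → ℕ} :
    c ∈ pictures h w ↔ IsKostant (fun _ => h) c := by
  simp only [pictures, Finset.mem_filter, mem_subPictures, and_iff_right_iff_imp]
  exact fun hc => ⟨hc.1, fun m => (hc.2 m).le⟩

lemma KPF_eq_card (h w : ℕ) : KPF (fun _ : Fin w => h) = (pictures h w).card := by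
  rw [KPF, ← Set.ncard_coe_finset]
  congr 1
  ext c
  simp [mem_pictures]

/-- The number of `k`-colorings of a picture. -/
def numColorings {w : ℕ} (k : ℕ) (c : Fin w → Fin w → ℕ) : ℕ :=
  ∏ i : Fin w, ∏ j : Fin w, (if i ≤ j then Nat.choose (c i j + k - 1) (k - 1) else 1)

lemma numColorings_mono {w : ℕ} (k : ℕ) {c d : Fin w → Fin w → ℕ} (h : ∀ i j, c i j ≤ d i j) :
    numColorings k c ≤ numColorings k d := by
  refine Finset.prod_le_prod' fun i _ => Finset.prod_le_prod' fun j _ => ?_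
  split_ifs
  · have := h i j
    exact Nat.choose_le_choose _ (by omega)
  · exact le_rfl

lemma numColorings_le_Tcol {h w : ℕ} (k : ℕ) {c : Fin w → Fin w → ℕ} (hc : c ∈ subPictures h w) :
    numColorings k c ≤ Tcol k (fun _ : Fin w => h) := by
  rw [mem_subPictures] at hc
  refine (numColorings_mono k (le_fillDiag (fun _ => h) c)).trans ?_
  refine le_csSup ?_ ⟨_, isKostant_fillDiag hc.1 hc.2, rfl⟩
  refine Set.Finite.bddAbove (Set.Finite.image _ ?_)
  refine (pictures h w).finite_toSet.subset fun c hc => ?_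
  exact mem_pictures.2 hc

lemma sum_comp_le_of_injOn {α ι : Type*} [Fintype ι] [DecidableEq ι] {M : Type*}
    [AddCommMonoid M] [PartialOrder M] [IsOrderedAddMonoid M] (s : Finset α) {f : α → ι}
    (hf : Set.InjOn f s) {g : ι → M} (hg : ∀ y, 0 ≤ g y) : ∑ x ∈ s, g (f x) ≤ ∑ y, g y := by
  rw [← Finset.sum_image hf]
  exact Finset.sum_le_sum_of_subset_of_nonneg (Finset.subset_univ _) fun y _ _ => hg y

/-- The loops of a picture of width `m * w` inside the `a`-th block of length `w`. -/
def blockPart {m w : ℕ} (c : Fin (m * w) → Fin (m * w) → ℕ) (a : Fin m) : Fin w → Fin w → ℕ :=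
  fun s t => c (finProdFinEquiv (a, s)) (finProdFinEquiv (a, t))

/-- The loops of a picture of width `m * w` that start in the `a`-th block and end in the
`(b + 1)`-st block of length `w`, sorted by their positions within the blocks. -/
def crossPart {m w : ℕ} (c : Fin (m * w) → Fin (m * w) → ℕ) (a b : Fin m) :
    Fin w × Fin w → ℕ :=
  fun x => if h : a ≤ b ∧ (b : ℕ) + 1 < m then
    c (finProdFinEquiv (a, x.1)) (finProdFinEquiv (⟨b + 1, h.2⟩, x.2)) else 0

lemma coverage_eq_sum_prod {w : ℕ} (c : Fin w → Fin w → ℕ) (m : Fin w) :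
    coverage c m = ∑ x : Fin w × Fin w, (if x.1 ≤ m ∧ m ≤ x.2 then c x.1 x.2 else 0) := by
  rw [coverage, Fintype.sum_prod_type]

lemma coverage_blockPart_le {m w : ℕ} (c : Fin (m * w) → Fin (m * w) → ℕ) (a : Fin m)
    (u : Fin w) : coverage (blockPart c a) u ≤ coverage c (finProdFinEquiv (a, u)) := by
  rw [coverage_eq_sum_prod, coverage_eq_sum_prod]
  have hinj : Set.InjOn (fun x : Fin w × Fin w =>
      ((finProdFinEquiv (a, x.1), finProdFinEquiv (a, x.2)) : Fin (m * w) × Fin (m * w)))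
      (Finset.univ : Finset (Fin w × Fin w)) := by
    rintro ⟨x1, x2⟩ _ ⟨y1, y2⟩ _ h
    simpa using h
  refine le_trans (le_of_eq ?_) (sum_comp_le_of_injOn Finset.univ hinj
    (g := fun x => if x.1 ≤ finProdFinEquiv (a, u) ∧ finProdFinEquiv (a, u) ≤ x.2
      then c x.1 x.2 else 0) (fun _ => Nat.zero_le _))
  refine Finset.sum_congr rfl fun x _ => ?_
  simp only [blockPart, Fin.le_def, finProdFinEquiv_apply_val]
  simp

lemma coverage_crossPart_le {m w : ℕ} (hw : 0 < w) (c : Fin (m * w) → Fin (m * w) → ℕ)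
    (p : Fin m) : coverage (fun a b => ∑ x, crossPart c a b x) p ≤
      coverage c (finProdFinEquiv (p, ⟨w - 1, by omega⟩)) := by
  classical
  rw [coverage_eq_sum_prod, coverage_eq_sum_prod]
  set u : Fin (m * w) := finProdFinEquiv (p, ⟨w - 1, by omega⟩) with hu
  let S : Finset ((Fin m × Fin m) × (Fin w × Fin w)) :=
    Finset.univ.filter fun y => y.1.1 ≤ p ∧ p ≤ y.1.2 ∧ (y.1.2 : ℕ) + 1 < m
  let f : (Fin m × Fin m) × (Fin w × Fin w) → Fin (m * w) × Fin (m * w) := fun y =>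
    (finProdFinEquiv (y.1.1, y.2.1), if h : (y.1.2 : ℕ) + 1 < m then
      finProdFinEquiv (⟨y.1.2 + 1, h⟩, y.2.2) else u)
  have hinj : Set.InjOn f S := by
    rintro ⟨⟨a, b⟩, ⟨s, t⟩⟩ h1 ⟨⟨a', b'⟩, ⟨s', t'⟩⟩ h2 h
    simp only [S, Finset.coe_filter, Finset.mem_univ, true_and, Set.mem_ofPred_eq] at h1 h2
    simp only [f, h1.2.2, h2.2.2, dif_pos, Prod.mk.injEq, EmbeddingLike.apply_eq_iff_eq,
      Fin.mk.injEq, Nat.add_right_cancel_iff] at h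
    obtain ⟨⟨rfl, rfl⟩, h3, rfl⟩ := h
    rw [Fin.ext h3]
  refine le_trans (le_of_eq ?_) (sum_comp_le_of_injOn S hinj
    (g := fun x => if x.1 ≤ u ∧ u ≤ x.2 then c x.1 x.2 else 0) (fun _ => Nat.zero_le _))
  rw [Finset.sum_filter, Fintype.sum_prod_type (α₁ := Fin m × Fin m) (α₂ := Fin w × Fin w)]
  refine Finset.sum_congr rfl fun ab _ => ?_
  obtain ⟨a, b⟩ := ab
  by_cases h : a ≤ p ∧ p ≤ b
  · rw [if_pos h]
    refine Finset.sum_congr rfl fun x _ => ?_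
    by_cases h2 : (b : ℕ) + 1 < m
    · have h3 : finProdFinEquiv (a, x.1) ≤ u := by
        have := x.1.2
        have h4 : w * a ≤ w * p := Nat.mul_le_mul_left _ h.1
        simp only [hu, Fin.le_def, finProdFinEquiv_apply_val]
        omega
      have h4 : u ≤ finProdFinEquiv (⟨b + 1, h2⟩, x.2) := by
        have h4 : w * (p + 1) ≤ w * (b + 1) := Nat.mul_le_mul_left _ (Nat.succ_le_succ h.2)
        simp only [hu, Fin.le_def, finProdFinEquiv_apply_val]
        rw [mul_add] at h4
        omega
      simp [crossPart, f, h, h2, h.1.trans h.2, h3, h4]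
    · simp [crossPart, h2]
  · rw [if_neg h]
    symm
    refine Finset.sum_eq_zero fun x _ => if_neg ?_
    tauto

lemma card_piAntidiag_univ {ι : Type*} [Fintype ι] [DecidableEq ι] (n : ℕ) :
    (Finset.piAntidiag (Finset.univ : Finset ι) n).card =
      (n + Fintype.card ι - 1).choose n := by
  have := Finset.card_finsuppAntidiag_nat_eq_choose (s := (Finset.univ : Finset ι)) n
  rw [Finset.finsuppAntidiag, Finset.card_map, Finset.card_attach, Finset.card_univ] at this
  rw [this, add_comm]

/-- The pictures of width `m * w` are encoded by their restrictions to blocks together with the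
contracted picture of the loops between distinct blocks, colored by positions in blocks. -/
lemma card_pictures_mul_le (h m w : ℕ) (hw : 0 < w) :
    (pictures h (m * w)).card ≤
      (pictures h w).card ^ m * ∑ d ∈ subPictures h m, numColorings (w ^ 2) d := by
  classical
  let B : Finset (Fin m → Fin w → Fin w → ℕ) := Fintype.piFinset fun _ => pictures h w
  let C : Finset (Σ _ : Fin m → Fin m → ℕ, Fin m → Fin m → Fin w × Fin w → ℕ) :=
    (subPictures h m).sigma fun d => Fintype.piFinset fun a => Fintype.piFinset fun b =>
      Finset.piAntidiag Finset.univ (d a b)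
  have hcard : (B ×ˢ C).card =
      (pictures h w).card ^ m * ∑ d ∈ subPictures h m, numColorings (w ^ 2) d := by
    rw [Finset.card_product, show B.card = (pictures h w).card ^ m by simp [B], Finset.card_sigma]
    congr 1
    refine Finset.sum_congr rfl fun d hd => ?_
    rw [Fintype.card_piFinset]
    refine Finset.prod_congr rfl fun a _ => ?_
    rw [Fintype.card_piFinset]
    refine Finset.prod_congr rfl fun b _ => ?_
    rw [card_piAntidiag_univ, Fintype.card_prod, Fintype.card_fin, ← sq]
    have : 0 < w ^ 2 := by positivity
    split_ifs with hab
    · exact Nat.choose_symm_of_eq_add (by omega)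
    · rw [(mem_subPictures.1 hd).1 a b (not_le.1 hab)]
      simp
  rw [← hcard]
  refine Finset.card_le_card_of_injOn
    (fun c => (fun a => fillDiag (fun _ => h) (blockPart c a),
      ⟨fun a b => ∑ x, crossPart c a b x, crossPart c⟩)) ?_ ?_
  · intro c hc
    have hc := mem_pictures.1 hc
    simp only [Finset.coe_product, Set.mem_prod, Finset.mem_coe, B, C, Fintype.mem_piFinset,
      Finset.mem_sigma, mem_pictures, mem_subPictures, Finset.mem_piAntidiag]
    refine ⟨fun a => isKostant_fillDiag (fun s t hst => hc.1 _ _ ?_)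
      (fun u => (coverage_blockPart_le c a u).trans (hc.2 _).le), ⟨fun a b hab => ?_,
      fun p => (coverage_crossPart_le hw c p).trans (hc.2 _).le⟩, by simp⟩
    · have := Fin.lt_def.1 hst
      simp only [Fin.lt_def, finProdFinEquiv_apply_val]
      omega
    · exact Finset.sum_eq_zero fun x _ => dif_neg fun h => absurd h.1 (not_le.2 hab)
  · intro c hc c' hc' heq
    have hc := mem_pictures.1 hc
    have hc' := mem_pictures.1 hc'
    simp only [Prod.mk.injEq, Sigma.mk.injEq, heq_eq_eq] at heq
    obtain ⟨h1, -, h2⟩ := heq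
    refine hc.eq_of_off_diag hc' fun i j hij => ?_
    rcases lt_or_gt_of_ne hij with hij | hij
    swap
    · rw [hc.1 i j hij, hc'.1 i j hij]
    obtain ⟨⟨a, s⟩, rfl⟩ := finProdFinEquiv.surjective i
    obtain ⟨⟨b, t⟩, rfl⟩ := finProdFinEquiv.surjective j
    by_cases hab : a = b
    · subst hab
      have hst : s ≠ t := by rintro rfl; exact lt_irrefl _ hij
      have := congrFun (congrFun (congrFun h1 a) s) t
      rwa [fillDiag_of_ne _ _ hst, fillDiag_of_ne _ _ hst] at this
    · have hab' : (a : ℕ) < b := by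
        by_contra hcon
        have h3 : (b : ℕ) + 1 ≤ a := by
          have : (a : ℕ) ≠ b := fun h => hab (Fin.ext h)
          omega
        have h4 := Nat.mul_le_mul_left w h3
        have := t.2
        simp only [Fin.lt_def, finProdFinEquiv_apply_val] at hij
        rw [mul_add] at h4
        omega
      have hb := b.2
      have := congrFun (congrFun (congrFun h2 a) ⟨b - 1, by omega⟩) (s, t)
      have h5 : a ≤ (⟨b - 1, by omega⟩ : Fin m) := by
        simp only [Fin.le_def]; omega
      have h6 : (b : ℕ) - 1 + 1 = b := by omega
      simpa [crossPart, h5, h6, hb] using this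

lemma KPF_mul_le (h m w : ℕ) (hw : 0 < w) :
    KPF (fun _ : Fin (m * w) => h) ≤ KPF (fun _ : Fin w => h) ^ m *
      ((subPictures h m).card * Tcol (w ^ 2) (fun _ : Fin m => h)) := by
  rw [KPF_eq_card, KPF_eq_card]
  refine (card_pictures_mul_le h m w hw).trans (Nat.mul_le_mul_left _ ?_)
  rw [← smul_eq_mul]
  exact Finset.sum_le_card_nsmul _ _ _ fun d hd => numColorings_le_Tcol _ hd

lemma zero_mem_subPictures (h m : ℕ) : (fun _ _ => 0) ∈ subPictures h m := by
  simp [mem_subPictures, coverage]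

lemma KPF_pos (h w : ℕ) : 0 < KPF (fun _ : Fin w => h) := by
  rw [KPF_eq_card, Finset.card_pos]
  have := mem_subPictures.1 (zero_mem_subPictures h w)
  exact ⟨_, mem_pictures.2 (isKostant_fillDiag this.1 this.2)⟩

lemma numColorings_pos {w : ℕ} (k : ℕ) (c : Fin w → Fin w → ℕ) : 0 < numColorings k c := by
  refine Finset.prod_pos fun i _ => Finset.prod_pos fun j _ => ?_
  split_ifs
  · exact Nat.choose_pos (by omega)
  · exact one_pos

lemma Tcol_pos (k h w : ℕ) : 0 < Tcol k (fun _ : Fin w => h) :=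
  (numColorings_pos k _).trans_le (numColorings_le_Tcol k (zero_mem_subPictures h w))

lemma Lbox_mul_le (h m w : ℕ) (hw : 0 < w) :
    Lbox h (m * w) ≤ m * Lbox h w + (Real.log (subPictures h m).card + Lcol (w ^ 2) h m) := by
  have h1 : (0 : ℝ) < KPF (fun _ : Fin w => h) := by exact_mod_cast KPF_pos h w
  have h2 : (0 : ℝ) < Tcol (w ^ 2) (fun _ : Fin m => h) := by exact_mod_cast Tcol_pos _ h m
  have h3 : (0 : ℝ) < (subPictures h m).card := by
    exact_mod_cast Finset.card_pos.2 ⟨_, zero_mem_subPictures h m⟩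
  have h4 : (0 : ℝ) < KPF (fun _ : Fin (m * w) => h) := by exact_mod_cast KPF_pos h _
  rw [Lbox, Lbox, Lcol, ← Real.log_mul h3.ne' h2.ne', ← Real.log_pow,
    ← Real.log_mul (by positivity) (by positivity)]
  exact Real.log_le_log h4 (by exact_mod_cast KPF_mul_le h m w hw)

/-- The function `t ↦ -log (1 - exp (-t))`, the logarithm of a full geometric series. -/
noncomputable def logGeom (t : ℝ) : ℝ := -Real.log (1 - Real.exp (-t))

lemma logGeom_nonneg {t : ℝ} (ht : 0 < t) : 0 ≤ logGeom t := by
  have h1 : Real.exp (-t) < 1 := Real.exp_lt_one_iff.2 (by linarith)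
  have h2 := Real.exp_pos (-t)
  have := Real.log_nonpos (x := 1 - Real.exp (-t)) (by linarith) (by linarith)
  unfold logGeom
  linarith

lemma logGeom_le_log {t : ℝ} (ht : 0 < t) : logGeom t ≤ Real.log (1 + 1 / t) := by
  have h1 : 1 + t ≤ Real.exp t := by linarith [Real.add_one_le_exp t]
  have h2 : Real.exp (-t) ≤ 1 / (1 + t) := by
    rw [Real.exp_neg, ← one_div]
    exact one_div_le_one_div_of_le (by linarith) h1
  have h3 : (1 + 1 / t)⁻¹ ≤ 1 - Real.exp (-t) := by
    have : (1 + 1 / t)⁻¹ = 1 - 1 / (1 + t) := by field_simp; ring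
    linarith
  have h4 := Real.log_le_log (by positivity) h3
  rw [Real.log_inv] at h4
  unfold logGeom
  linarith

lemma logGeom_le_inv_sq {t : ℝ} (ht : 0 < t) : logGeom t ≤ 2 / t ^ 2 := by
  have h1 : 1 + t + t ^ 2 / 2 ≤ Real.exp t := Real.quadratic_le_exp_of_nonneg ht.le
  have h2 : Real.exp (-t) ≤ 1 / (1 + t ^ 2 / 2) := by
    rw [Real.exp_neg, ← one_div]
    exact one_div_le_one_div_of_le (by positivity) (by linarith)
  have h3 : (1 + 2 / t ^ 2)⁻¹ ≤ 1 - Real.exp (-t) := by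
    have : (1 + 2 / t ^ 2)⁻¹ = 1 - 1 / (1 + t ^ 2 / 2) := by field_simp; ring
    linarith
  have h4 := Real.log_le_log (by positivity) h3
  have h5 := Real.log_le_sub_one_of_pos (x := 1 + 2 / t ^ 2) (by positivity)
  rw [Real.log_inv] at h4
  unfold logGeom
  linarith

lemma sum_exp_le_exp_logGeom {t : ℝ} (ht : 0 < t) (n : ℕ) :
    ∑ v ∈ Finset.range n, Real.exp (-t * v) ≤ Real.exp (logGeom t) := by
  have h1 : Real.exp (-t) < 1 := Real.exp_lt_one_iff.2 (by linarith)
  have h2 : ∀ v : ℕ, Real.exp (-t * v) = Real.exp (-t) ^ v := fun v => by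
    rw [← Real.exp_nat_mul, mul_comm]
  rw [logGeom, ← Real.log_inv, Real.exp_log (by rw [inv_pos]; linarith)]
  simp only [h2]
  rw [← tsum_geometric_of_lt_one (Real.exp_pos _).le h1]
  exact (summable_geometric_of_lt_one (Real.exp_pos _).le h1).sum_le_tsum _
    fun _ _ => by positivity

lemma sum_coverage {m : ℕ} (d : Fin m → Fin m → ℕ) :
    ∑ p, coverage d p = ∑ a : Fin m, ∑ b : Fin m, ((b : ℕ) + 1 - a) * d a b := by
  unfold coverage
  rw [Finset.sum_comm]
  refine Finset.sum_congr rfl fun a _ => ?_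
  rw [Finset.sum_comm]
  refine Finset.sum_congr rfl fun b _ => ?_
  rw [← Finset.sum_filter, Finset.sum_const, smul_eq_mul, ← Fin.card_Icc]
  congr 2
  ext p
  simp

lemma sum_row_le {m : ℕ} (a : Fin m) {f : ℕ → ℝ} (hf : ∀ r, 0 < r → 0 ≤ f r) :
    ∑ b : Fin m, (if a ≤ b then f ((b : ℕ) + 1 - a) else 0) ≤ ∑ r ∈ Finset.Ioc 0 m, f r := by
  rw [← Finset.sum_filter]
  have hinj : Set.InjOn (fun b : Fin m => (b : ℕ) + 1 - a)
      (Finset.univ.filter fun b : Fin m => a ≤ b) := by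
    intro b hb b' hb' h
    have h1 := Fin.le_def.1 (Finset.mem_filter.1 hb).2
    have h2 := Fin.le_def.1 (Finset.mem_filter.1 hb').2
    simp only at h
    exact Fin.ext (by omega)
  rw [← Finset.sum_image (f := f) hinj]
  refine Finset.sum_le_sum_of_subset_of_nonneg ?_ fun r hr _ => hf r (Finset.mem_Ioc.1 hr).1
  intro r hr
  obtain ⟨b, hb, rfl⟩ := Finset.mem_image.1 hr
  have h1 := Fin.le_def.1 (Finset.mem_filter.1 hb).2
  have := b.2
  rw [Finset.mem_Ioc]
  omega

lemma log_card_subPictures_le (h m : ℕ) {l : ℝ} (hl : 0 < l) :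
    Real.log (subPictures h m).card ≤
      l * (h * m) + m * ∑ r ∈ Finset.Ioc 0 m, logGeom (l * r) := by
  classical
  let A : Fin m → Fin m → Finset ℕ := fun a b => if a ≤ b then Finset.range (h + 1) else {0}
  let F : Fin m → Fin m → ℕ → ℝ := fun a b v => Real.exp (-(l * ((b : ℕ) + 1 - a : ℕ)) * v)
  have hone : ∀ d ∈ subPictures h m,
      1 ≤ Real.exp (l * (h * m)) * ∏ a, ∏ b, F a b (d a b) := by
    intro d hd
    have h1 : ∑ p, coverage d p ≤ h * m := by
      refine (Finset.sum_le_card_nsmul _ _ h fun p _ => (mem_subPictures.1 hd).2 p).trans ?_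
      simp [mul_comm]
    rw [sum_coverage] at h1
    have h2 : ∑ a : Fin m, ∑ b : Fin m, (((b : ℕ) + 1 - a : ℕ) : ℝ) * d a b ≤ h * m := by
      exact_mod_cast h1
    simp only [F, ← Real.exp_sum, ← Real.exp_add]
    rw [Real.one_le_exp_iff]
    have h3 : ∑ a : Fin m, ∑ b : Fin m, -(l * (((b : ℕ) + 1 - a : ℕ) : ℝ)) * d a b =
        -l * ∑ a : Fin m, ∑ b : Fin m, (((b : ℕ) + 1 - a : ℕ) : ℝ) * d a b := by
      simp only [Finset.mul_sum]
      refine Finset.sum_congr rfl fun a _ => Finset.sum_congr rfl fun b _ => by ring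
    rw [h3]
    nlinarith
  have hfac : ∀ a b, ∑ v ∈ A a b, F a b v ≤
      Real.exp (if a ≤ b then logGeom (l * ((b : ℕ) + 1 - a : ℕ)) else 0) := by
    intro a b
    by_cases hab : a ≤ b
    · simp only [A, F, if_pos hab]
      refine sum_exp_le_exp_logGeom (mul_pos hl ?_) _
      have := Fin.le_def.1 hab
      exact_mod_cast (by omega : 0 < (b : ℕ) + 1 - a)
    · simp [A, F, hab]
  have hcard : ((subPictures h m).card : ℝ) ≤ Real.exp (l * (h * m)) *
      ∏ a : Fin m, ∏ b : Fin m,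
        Real.exp (if a ≤ b then logGeom (l * ((b : ℕ) + 1 - a : ℕ)) else 0) := by
    calc ((subPictures h m).card : ℝ) = ∑ d ∈ subPictures h m, 1 := by simp
      _ ≤ ∑ d ∈ subPictures h m, Real.exp (l * (h * m)) * ∏ a, ∏ b, F a b (d a b) :=
          Finset.sum_le_sum hone
      _ ≤ ∑ d ∈ Fintype.piFinset fun a => Fintype.piFinset fun b => A a b,
            Real.exp (l * (h * m)) * ∏ a, ∏ b, F a b (d a b) := by
          refine Finset.sum_le_sum_of_subset_of_nonneg (Finset.filter_subset _ _) ?_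
          intro _ _ _
          exact mul_nonneg (Real.exp_pos _).le (Finset.prod_nonneg fun _ _ =>
            Finset.prod_nonneg fun _ _ => (Real.exp_pos _).le)
      _ = Real.exp (l * (h * m)) * ∏ a, ∏ b, ∑ v ∈ A a b, F a b v := by
          rw [← Finset.mul_sum]
          simp only [Finset.prod_univ_sum]
      _ ≤ _ := by
          refine mul_le_mul_of_nonneg_left ?_ (Real.exp_pos _).le
          refine Finset.prod_le_prod (fun _ _ => Finset.prod_nonneg fun _ _ =>
            Finset.sum_nonneg fun _ _ => (Real.exp_pos _).le) fun a _ => ?_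
          exact Finset.prod_le_prod (fun _ _ => Finset.sum_nonneg fun _ _ => (Real.exp_pos _).le)
            fun b _ => hfac a b
  simp only [← Real.exp_sum, ← Real.exp_add] at hcard
  have hpos : (0 : ℝ) < (subPictures h m).card := by
    exact_mod_cast Finset.card_pos.2 ⟨_, zero_mem_subPictures h m⟩
  refine ((Real.log_le_iff_le_exp hpos).2 hcard).trans ?_
  refine add_le_add le_rfl ?_
  refine (Finset.sum_le_card_nsmul _ _ _ fun a _ => sum_row_le (f := fun r => logGeom (l * r)) a
    fun r hr => logGeom_nonneg (by positivity)).trans ?_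
  simp

lemma prod_Ioc_id_eq_factorial (s : ℕ) : ∏ r ∈ Finset.Ioc 0 s, r = s.factorial := by
  induction s with
  | zero => simp
  | succ s ih => rw [Finset.prod_Ioc_succ_top (Nat.zero_le s), ih, Nat.factorial_succ, mul_comm]

lemma sum_log_div_le (s : ℕ) : ∑ r ∈ Finset.Ioc 0 s, Real.log ((s : ℝ) / r) ≤ s := by
  rcases Nat.eq_zero_or_pos s with rfl | hs
  · simp
  have hs' : (0 : ℝ) < s := by exact_mod_cast hs
  rw [← Real.log_prod]
  · have h1 : ∏ r ∈ Finset.Ioc 0 s, ((s : ℝ) / r) = (s : ℝ) ^ s / s.factorial := by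
      rw [Finset.prod_div_distrib, Finset.prod_const, Nat.card_Ioc, Nat.sub_zero,
        ← prod_Ioc_id_eq_factorial]
      push_cast
      rfl
    rw [h1]
    exact (Real.log_le_iff_le_exp (by positivity)).2 (Real.pow_div_factorial_le_exp _ hs'.le s)
  · intro r hr
    have : 0 < r := (Finset.mem_Ioc.1 hr).1
    positivity

/-- An upper bound for the number of pictures of height at most `h` and width `m`, in terms of a
length `s` comparable to `min (√h) m` and a multiplicity `q` comparable to `h / s ^ 2`. -/
lemma log_card_subPictures_le_mul {h m s q : ℕ} (hs : 0 < s) (hsm : s ≤ m) (hq : 0 < q)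
    (hsq : s ^ 2 * q ≤ h) (hsq' : h < s ^ 2 * (q + 1)) (hsmall : s < m → h < 4 * s ^ 2) :
    Real.log (subPictures h m).card ≤ 70 * (m * s * Real.log (1 + q)) := by
  have hs' : (0 : ℝ) < s := by exact_mod_cast hs
  have hq' : (1 : ℝ) ≤ q := by exact_mod_cast hq
  have hh : 0 < h := lt_of_lt_of_le (by positivity) hsq
  have hh' : (0 : ℝ) < h := by exact_mod_cast hh
  have hm' : (0 : ℝ) ≤ m := by positivity
  have hlog : 1 / 2 ≤ Real.log (1 + q) := by
    have h1 := Real.log_two_gt_d9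
    have h2 := Real.log_le_log (by norm_num : (0 : ℝ) < 2) (by linarith : (2 : ℝ) ≤ 1 + q)
    linarith
  have hratio : (h : ℝ) / s ^ 2 ≤ q + 1 := by
    rw [div_le_iff₀ (by positivity)]
    have : (h : ℝ) < s ^ 2 * (q + 1) := by exact_mod_cast hsq'
    linarith
  have hhead : ∑ r ∈ Finset.Ioc 0 s, logGeom ((s : ℝ) / h * r) ≤
      s * (2 * Real.log (1 + q)) + s := by
    have h1 : ∀ r ∈ Finset.Ioc 0 s, logGeom ((s : ℝ) / h * r) ≤
        2 * Real.log (1 + q) + Real.log ((s : ℝ) / r) := by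
      intro r hr
      have hr1 := (Finset.mem_Ioc.1 hr).1
      have hr2 : (r : ℝ) ≤ s := by exact_mod_cast (Finset.mem_Ioc.1 hr).2
      have hr' : (0 : ℝ) < r := by exact_mod_cast hr1
      refine (logGeom_le_log (by positivity)).trans ?_
      have h2 : 2 * Real.log (1 + q) = Real.log ((1 + q) ^ 2) := by
        rw [Real.log_pow]; norm_num
      rw [h2, ← Real.log_mul (by positivity) (by positivity)]
      refine Real.log_le_log (by positivity) ?_
      calc 1 + 1 / ((s : ℝ) / h * r) ≤ s / r + 1 / ((s : ℝ) / h * r) := by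
            gcongr
            rwa [one_le_div hr']
        _ = (1 + h / s ^ 2) * (s / r) := by field_simp
        _ ≤ (1 + q) ^ 2 * (s / r) := by
            gcongr
            nlinarith
    refine (Finset.sum_le_sum h1).trans ?_
    rw [Finset.sum_add_distrib, Finset.sum_const, Nat.card_Ioc, Nat.sub_zero, nsmul_eq_mul]
    linarith [sum_log_div_le s]
  have htail : ∑ r ∈ Finset.Ioc s m, logGeom ((s : ℝ) / h * r) ≤ 32 * s := by
    rcases hsm.eq_or_lt with rfl | hlt
    · simp
    have h4 : (h : ℝ) ≤ 4 * s ^ 2 := by exact_mod_cast (hsmall hlt).le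
    have h1 : ∀ r ∈ Finset.Ioc s m, logGeom ((s : ℝ) / h * r) ≤
        2 * (h / s) ^ 2 * ((r : ℝ) ^ 2)⁻¹ := by
      intro r hr
      have hr' : (0 : ℝ) < r := by exact_mod_cast hs.trans (Finset.mem_Ioc.1 hr).1
      refine (logGeom_le_inv_sq (by positivity)).trans (le_of_eq ?_)
      field_simp
    refine (Finset.sum_le_sum h1).trans ?_
    rw [← Finset.mul_sum]
    have h2 : ∑ r ∈ Finset.Ioc s m, ((r : ℝ) ^ 2)⁻¹ ≤ (s : ℝ)⁻¹ := by
      refine (sum_Ioc_inv_sq_le_sub hs.ne' hsm).trans ?_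
      have : (0 : ℝ) ≤ (m : ℝ)⁻¹ := by positivity
      linarith
    have h3 : (h : ℝ) / s ≤ 4 * s := by
      rw [div_le_iff₀ hs']
      linarith
    calc 2 * ((h : ℝ) / s) ^ 2 * (∑ r ∈ Finset.Ioc s m, ((r : ℝ) ^ 2)⁻¹ : ℝ)
        ≤ 2 * (4 * s) ^ 2 * (s : ℝ)⁻¹ := by gcongr
      _ = 32 * (s : ℝ) := by field_simp; norm_num
  have hmain := log_card_subPictures_le h m (l := (s : ℝ) / h) (by positivity)
  rw [← Finset.sum_Ioc_consecutive _ (Nat.zero_le s) hsm] at hmain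
  have h1 : (s : ℝ) / h * (h * m) = s * m := by field_simp
  rw [h1] at hmain
  refine hmain.trans ?_
  calc (s : ℝ) * m + m * (∑ r ∈ Finset.Ioc 0 s, logGeom ((s : ℝ) / h * r) +
        ∑ r ∈ Finset.Ioc s m, logGeom ((s : ℝ) / h * r))
      ≤ (s : ℝ) * m + m * ((s * (2 * Real.log (1 + q)) + s) + 32 * s) := by gcongr
    _ = m * s * (34 + 2 * Real.log (1 + q)) := by ring
    _ ≤ m * s * (70 * Real.log (1 + q)) := by gcongr; linarith
    _ = _ := by ring

lemma log_choose_ge (q j : ℕ) :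
    (∑ i ∈ Finset.range j, (1 / (i + 1) : ℝ)) * Real.log (1 + q) ≤
      Real.log ((q + j).choose j) := by
  induction j with
  | zero => simp
  | succ j ih =>
    have hj : (0 : ℝ) < (j : ℝ) + 1 := by positivity
    have hc : (0 : ℝ) < ((q + j).choose j : ℝ) := by
      exact_mod_cast Nat.choose_pos (Nat.le_add_left _ _)
    have h1 : ((q + (j + 1)).choose (j + 1) : ℝ) =
        (q + j).choose j * (1 + q / ((j : ℝ) + 1)) := by
      have := Nat.add_one_mul_choose_eq (q + j) j
      have h2 : ((q : ℝ) + j + 1) * (q + j).choose j =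
          (q + j + 1).choose (j + 1) * ((j : ℝ) + 1) := by exact_mod_cast this
      rw [← add_assoc]
      field_simp
      linarith
    have h2 : 1 / ((j : ℝ) + 1) * Real.log (1 + q) ≤ Real.log (1 + q / ((j : ℝ) + 1)) := by
      have h3 : (1 : ℝ) + q ≤ (1 + q / ((j : ℝ) + 1)) ^ (j + 1) := by
        have h4 := one_add_mul_le_pow (a := (q : ℝ) / ((j : ℝ) + 1))
          (by have : (0 : ℝ) ≤ (q : ℝ) / ((j : ℝ) + 1) := by positivity
              linarith) (j + 1)
        have h5 : ((j + 1 : ℕ) : ℝ) * ((q : ℝ) / ((j : ℝ) + 1)) = q := by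
          push_cast
          field_simp
        rwa [h5] at h4
      have h4 := Real.log_le_log (by positivity) h3
      rw [Real.log_pow] at h4
      push_cast at h4
      rw [one_div, inv_mul_le_iff₀ hj]
      exact h4
    rw [Finset.sum_range_succ, add_mul, h1, Real.log_mul hc.ne' (by positivity)]
    exact add_le_add ih h2

/-- The picture with `q` copies of every loop on at most `s` vertices. -/
def shortLoops (m s q : ℕ) : Fin m → Fin m → ℕ :=
  fun i j => if i ≤ j ∧ (j : ℕ) < i + s then q else 0

lemma shortLoops_mem_subPictures {h m s q : ℕ} (hsq : s ^ 2 * q ≤ h) :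
    shortLoops m s q ∈ subPictures h m := by
  classical
  rw [mem_subPictures]
  refine ⟨fun i j hij => by simp [shortLoops, not_le.2 hij], fun p => le_trans ?_ hsq⟩
  rw [coverage_eq_sum_prod]
  let S : Finset (Fin m × Fin m) :=
    Finset.univ.filter fun x => (x.1 ≤ p ∧ p ≤ x.2) ∧ (x.2 : ℕ) < x.1 + s
  have h1 : S.card ≤ s ^ 2 := by
    have h2 : (Finset.range s ×ˢ Finset.range s).card = s ^ 2 := by simp [sq]
    rw [← h2]
    refine Finset.card_le_card_of_injOn (fun x => ((p : ℕ) - x.1, (x.2 : ℕ) - p)) ?_ ?_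
    · rintro ⟨i, j⟩ hx
      have := (Finset.mem_filter.1 hx).2
      simp only [Fin.le_def] at this
      simp only [Finset.coe_product, Set.mem_prod, Finset.mem_coe, Finset.mem_range]
      omega
    · rintro ⟨i, j⟩ hx ⟨i', j'⟩ hx' heq
      have h3 := (Finset.mem_filter.1 hx).2
      have h4 := (Finset.mem_filter.1 hx').2
      simp only [Fin.le_def] at h3 h4
      simp only [Prod.mk.injEq] at heq
      exact Prod.ext (Fin.ext (by simp only; omega)) (Fin.ext (by simp only; omega))
  calc ∑ x : Fin m × Fin m, (if x.1 ≤ p ∧ p ≤ x.2 then shortLoops m s q x.1 x.2 else 0)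
      = ∑ x ∈ S, q := by
        rw [Finset.sum_filter]
        refine Finset.sum_congr rfl fun x _ => ?_
        by_cases h1 : x.1 ≤ p ∧ p ≤ x.2
        · simp [shortLoops, h1, h1.1.trans h1.2]
        · simp [h1]
    _ = S.card * q := by simp
    _ ≤ s ^ 2 * q := Nat.mul_le_mul_right _ h1

lemma two_mul_sum_sub (m s : ℕ) (hs : s ≤ m) :
    2 * ∑ d ∈ Finset.range s, (m - d) + s * s = s * (2 * m + 1) := by
  induction s with
  | zero => simp
  | succ s ih =>
    have := ih (by omega)
    rw [Finset.sum_range_succ]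
    obtain ⟨e, rfl⟩ : ∃ e, m = s + e := ⟨m - s, by omega⟩
    rw [Nat.add_sub_cancel_left]
    nlinarith

lemma mul_le_two_mul_card_short {m s : ℕ} (hsm : s ≤ m) :
    m * s ≤ 2 * (Finset.univ.filter fun x : Fin m × Fin m =>
      x.1 ≤ x.2 ∧ (x.2 : ℕ) < x.1 + s).card := by
  let T : Finset (Σ _ : ℕ, ℕ) := (Finset.range s).sigma fun d => Finset.range (m - d)
  have h1 : T.card ≤ (Finset.univ.filter fun x : Fin m × Fin m =>
      x.1 ≤ x.2 ∧ (x.2 : ℕ) < x.1 + s).card := by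
    refine Finset.card_le_card_of_surjOn (fun x => ⟨(x.2 : ℕ) - x.1, x.1⟩) ?_
    rintro ⟨d, i⟩ hdi
    simp only [T, Finset.coe_sigma, Finset.mem_coe, Set.mem_sigma_iff,
      Finset.mem_range] at hdi
    refine ⟨(⟨i, by omega⟩, ⟨i + d, by omega⟩), ?_, ?_⟩
    · simp only [Finset.coe_filter, Set.mem_ofPred_eq, Finset.mem_univ, true_and, Fin.le_def]
      omega
    · simp
  have h2 : T.card = ∑ d ∈ Finset.range s, (m - d) := by simp [T]
  have h3 := two_mul_sum_sub m s hsm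
  rw [h2] at h1
  nlinarith

lemma Lcol_ge {h m s q k : ℕ} (hsm : s ≤ m) (hk : 0 < k) (hsq : s ^ 2 * q ≤ h) :
    (∑ i ∈ Finset.range (k - 1), (1 / (i + 1) : ℝ)) * (m * s * Real.log (1 + q)) ≤
      2 * Lcol k h m := by
  set H : ℝ := ∑ i ∈ Finset.range (k - 1), (1 / (i + 1) : ℝ) with hH
  have hH0 : 0 ≤ H := Finset.sum_nonneg fun i _ => by positivity
  have hl0 : 0 ≤ Real.log (1 + q) := Real.log_nonneg (by linarith [q.cast_nonneg (α := ℝ)])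
  set S := Finset.univ.filter fun x : Fin m × Fin m => x.1 ≤ x.2 ∧ (x.2 : ℕ) < x.1 + s with hS
  have hcol : numColorings k (shortLoops m s q) = ((q + (k - 1)).choose (k - 1)) ^ S.card := by
    rw [numColorings, ← Fintype.prod_prod_type', ← Finset.prod_const, hS, Finset.prod_filter]
    refine Finset.prod_congr rfl fun x _ => ?_
    rw [Nat.add_sub_assoc hk]
    by_cases h1 : x.1 ≤ x.2
    · by_cases h2 : (x.2 : ℕ) < x.1 + s
      · simp [shortLoops, h1, h2]
      · simp [shortLoops, h1, h2]
    · simp [h1]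
  have h1 : (S.card : ℝ) * Real.log ((q + (k - 1)).choose (k - 1)) ≤ Lcol k h m := by
    rw [Lcol, ← Real.log_pow]
    have hpos := numColorings_pos k (shortLoops m s q)
    have hle := numColorings_le_Tcol k (shortLoops_mem_subPictures (m := m) hsq)
    rw [hcol] at hpos hle
    exact Real.log_le_log (by exact_mod_cast hpos) (by exact_mod_cast hle)
  have h2 : (m : ℝ) * s ≤ 2 * S.card := by exact_mod_cast mul_le_two_mul_card_short hsm
  have h3 := log_choose_ge q (k - 1)
  calc H * (m * s * Real.log (1 + q)) = (m * s) * (H * Real.log (1 + q)) := by ring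
    _ ≤ (2 * S.card) * (H * Real.log (1 + q)) := by gcongr
    _ ≤ (2 * S.card) * Real.log ((q + (k - 1)).choose (k - 1)) := by gcongr
    _ ≤ _ := by linarith

/-- There are few pictures compared with the number of colorings of the most colorable one. -/
lemma harmonic_mul_log_card_le {h m k : ℕ} (hh : 0 < h) (hm : 0 < m) (hk : 0 < k) :
    (∑ i ∈ Finset.range (k - 1), (1 / (i + 1) : ℝ)) * Real.log (subPictures h m).card ≤
      140 * Lcol k h m := by
  set s := min (Nat.sqrt h) m with hs
  have hs0 : 0 < s := lt_min (Nat.sqrt_pos.2 hh) hm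
  have hsh : s ^ 2 ≤ h := by
    have h1 := Nat.sqrt_le' h
    have h2 : s ^ 2 ≤ (Nat.sqrt h) ^ 2 := Nat.pow_le_pow_left (min_le_left _ _) 2
    omega
  have hsm : s ≤ m := min_le_right _ _
  set q := h / s ^ 2 with hq
  have hq0 : 0 < q := Nat.div_pos hsh (by positivity)
  have hsq : s ^ 2 * q ≤ h := Nat.mul_div_le _ _
  have hsq' : h < s ^ 2 * (q + 1) := Nat.lt_mul_div_succ h (by positivity)
  have hsmall : s < m → h < 4 * s ^ 2 := by
    intro hlt
    have h1 : s = Nat.sqrt h := by omega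
    have h2 := Nat.lt_succ_sqrt' h
    rw [← h1, Nat.succ_eq_add_one] at h2
    nlinarith
  have hup := log_card_subPictures_le_mul hs0 hsm hq0 hsq hsq' hsmall
  have hlow := Lcol_ge (h := h) hsm hk hsq
  have hH0 : 0 ≤ ∑ i ∈ Finset.range (k - 1), (1 / (i + 1) : ℝ) :=
    Finset.sum_nonneg fun i _ => by positivity
  have := mul_le_mul_of_nonneg_left hup hH0
  linarith

lemma Lbox_nonneg (h w : ℕ) : 0 ≤ Lbox h w := Real.log_natCast_nonneg _

lemma Lcol_nonneg (k h w : ℕ) : 0 ≤ Lcol k h w := Real.log_natCast_nonneg _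

/-- Upper bound in the decomposition proposition: if `w₀ ≻ w ≻ 1` (with `w ∣ w₀`) then
`L[h, w₀] ≾ (w₀/w)·L[h,w] + L^{w²}[h, w₀/w]`, i.e. the limsup of the ratio is at most `1`. -/
theorem decomposition_upper (h w w₀ : ℕ → ℕ)
    (hh : ∀ n, 0 < h n) (hwpos : ∀ n, 0 < w n) (hw₀pos : ∀ n, 0 < w₀ n)
    (hdvd : ∀ n, w n ∣ w₀ n)
    (hw1 : Tendsto (fun n => (1 : ℝ) / w n) atTop (nhds 0))
    (hww₀ : Tendsto (fun n => (w n : ℝ) / w₀ n) atTop (nhds 0)) :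
    Filter.limsup (fun n =>
        Lbox (h n) (w₀ n) /
          (((w₀ n / w n : ℕ) : ℝ) * Lbox (h n) (w n) +
            Lcol (w n ^ 2) (h n) (w₀ n / w n))) atTop ≤ 1 := by
  set H : ℕ → ℝ := fun n => ∑ i ∈ Finset.range (w n ^ 2 - 1), (1 / (i + 1) : ℝ) with hH
  have hwtop : Tendsto w atTop atTop := by
    have h1 : Tendsto (fun n => (w n : ℝ)⁻¹) atTop (nhdsWithin 0 (Set.Ioi 0)) := by
      refine tendsto_nhdsWithin_iff.2 ⟨by simpa using hw1, Eventually.of_forall fun n => ?_⟩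
      have := hwpos n
      simp only [Set.mem_Ioi]
      positivity
    have h2 := h1.inv_tendsto_nhdsGT_zero
    refine (tendsto_natCast_atTop_iff (R := ℝ)).1 (h2.congr fun n => ?_)
    simp
  have hHtop : Tendsto H atTop atTop := by
    refine Real.tendsto_sum_range_one_div_nat_succ_atTop.comp ?_
    refine tendsto_atTop_mono (fun n => ?_) ((tendsto_sub_atTop_nat 1).comp hwtop)
    have hle : w n ≤ w n ^ 2 := Nat.le_self_pow (by norm_num) _
    exact Nat.sub_le_sub_right hle 1
  have hbound : ∀ᶠ n in atTop, Lbox (h n) (w₀ n) /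
      (((w₀ n / w n : ℕ) : ℝ) * Lbox (h n) (w n) +
        Lcol (w n ^ 2) (h n) (w₀ n / w n)) ≤ 1 + 140 / H n := by
    filter_upwards [hHtop.eventually_gt_atTop 0] with n hn
    have hm : 0 < w₀ n / w n := Nat.div_pos (Nat.le_of_dvd (hw₀pos n) (hdvd n)) (hwpos n)
    have hmul : w₀ n / w n * w n = w₀ n := Nat.div_mul_cancel (hdvd n)
    have h1 := Lbox_mul_le (h n) (w₀ n / w n) (w n) (hwpos n)
    rw [hmul] at h1
    have h2 := harmonic_mul_log_card_le (k := w n ^ 2) (hh n) hm (pow_pos (hwpos n) 2)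
    change H n * _ ≤ _ at h2
    have h3 := Lbox_nonneg (h n) (w n)
    have h4 := Lcol_nonneg (w n ^ 2) (h n) (w₀ n / w n)
    have h5 : (0 : ℝ) ≤ ((w₀ n / w n : ℕ) : ℝ) * Lbox (h n) (w n) := by positivity
    have h6 : Real.log (subPictures (h n) (w₀ n / w n)).card ≤
        140 / H n * Lcol (w n ^ 2) (h n) (w₀ n / w n) := by
      rw [div_mul_eq_mul_div, le_div_iff₀ hn]
      linarith
    refine div_le_of_le_mul₀ (by positivity) (by positivity) ?_
    have h7 : 0 ≤ 140 / H n * (((w₀ n / w n : ℕ) : ℝ) * Lbox (h n) (w n)) := by positivity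
    linarith
  have hlim : Tendsto (fun n => 1 + 140 / H n) atTop (nhds 1) := by
    simpa using (hHtop.const_div_atTop 140).const_add 1
  refine (limsup_le_limsup hbound ?_ hlim.isBoundedUnder_le).trans hlim.limsup_eq.le
  refine IsBoundedUnder.isCoboundedUnder_le (isBoundedUnder_of_eventually_ge (a := 0)
    (Eventually.of_forall fun n => ?_))
  have h3 := Lbox_nonneg (h n) (w n)
  have h4 := Lcol_nonneg (w n ^ 2) (h n) (w₀ n / w n)
  have h5 := Lbox_nonneg (h n) (w₀ n)
  positivity
end

section
/- Let h, w, k : ℤ⁺ → ℤ⁺ with k ≻ 1. If h ≻ k·w², then L^k[h, w] ≍ k·w²·ln(h/(k·w²)); that is, there exist constants 0 < a ≤ b with a·k(n)·w(n)²·ln(h(n)/(k(n)·w(n)²)) ≤ L^{k(n)}[h(n), w(n)] ≤ b·k(n)·w(n)²·ln(h(n)/(k(n)·w(n)²)) for all large n. -/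
open Filter

/-- Weighted mass of a Kostant picture: each loop counts with its length. -/
lemma IsKostant.sum_mul_length {w : ℕ} {η : Fin w → ℕ} {c : Fin w → Fin w → ℕ}
    (hc : IsKostant η c) :
    ∑ i : Fin w, ∑ j : Fin w, c i j * ((j : ℕ) + 1 - i) = ∑ m, η m := by
  rw [← Finset.sum_congr rfl fun m _ => hc.2 m]
  refine Eq.trans (Finset.sum_congr rfl fun i _ => ?_) Finset.sum_comm
  refine Eq.trans (Finset.sum_congr rfl fun j _ => ?_) Finset.sum_comm
  rw [← Finset.sum_filter, Finset.sum_const, smul_eq_mul, mul_comm, ← Fin.card_Icc]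
  congr 2
  ext m
  simp

/-- A single term of the binomial expansion of `1 = (x + (1 - x)) ^ n` at `x = 1 / (1 + s)`. -/
lemma choose_le_pow_mul_pow (c r : ℕ) {s : ℝ} (hs : 0 < s) :
    ((c + r).choose r : ℝ) ≤ (1 + s) ^ c * ((1 + s) / s) ^ r := by
  have h := Finset.single_le_sum (f := fun m => s ^ m * 1 ^ (c + r - m) * ((c + r).choose m : ℝ))
    (s := Finset.range (c + r + 1)) (fun m _ => by positivity)
    (Finset.mem_range.2 (by omega : r < c + r + 1))
  rw [← add_pow, add_comm s 1] at h
  simp only [one_pow, mul_one] at h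
  rw [div_pow, mul_div_assoc', ← pow_add, le_div_iff₀ (by positivity)]
  linarith

lemma log_choose_le (c r : ℕ) {s : ℝ} (hs : 0 < s) (hs1 : s ≤ 1) :
    Real.log ((c + r).choose r : ℝ) ≤ c * s + r * Real.log (2 / s) := by
  have hpos : (0 : ℝ) < (c + r).choose r := by
    exact_mod_cast Nat.choose_pos (Nat.le_add_left r c)
  refine (Real.log_le_log hpos (choose_le_pow_mul_pow c r hs)).trans ?_
  rw [Real.log_mul (by positivity) (by positivity), Real.log_pow, Real.log_pow]
  gcongr
  · linarith [Real.log_le_sub_one_of_pos (by linarith : 0 < 1 + s)]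
  · linarith

lemma sum_log_div_succ_le (w : ℕ) :
    ∑ l ∈ Finset.range w, Real.log ((w : ℝ) / (l + 1 : ℝ)) ≤ w := by
  rcases Nat.eq_zero_or_pos w with rfl | hw
  · simp
  have hw' : (0 : ℝ) < w := by exact_mod_cast hw
  rw [← Real.log_prod (fun l _ => by positivity), Finset.prod_div_distrib, Finset.prod_const,
    Finset.card_range]
  have hf : ∏ l ∈ Finset.range w, ((l : ℝ) + 1) = (w.factorial : ℝ) := by
    rw [← Finset.prod_range_add_one_eq_factorial]
    push_cast
    rfl
  rw [hf, Real.log_le_iff_le_exp (by positivity)]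
  exact Real.pow_div_factorial_le_exp _ hw'.le _

lemma sum_log_div_length_le {w : ℕ} (i : Fin w) :
    ∑ j : Fin w, (if i ≤ j then Real.log ((w : ℝ) / ((j + 1 - i : ℕ) : ℝ)) else 0) ≤ w := by
  have h1 := Fin.sum_univ_eq_sum_range
    (fun j => if (i : ℕ) ≤ j then Real.log ((w : ℝ) / ((j + 1 - i : ℕ) : ℝ)) else 0) w
  simp only [Fin.le_def]
  rw [h1, ← Finset.sum_filter]
  have h2 : (Finset.range w).filter (fun j => (i : ℕ) ≤ j) = Finset.Ico (i : ℕ) w := by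
    ext j
    simp [and_comm]
  rw [h2, Finset.sum_Ico_eq_sum_range]
  refine le_trans ?_ (sum_log_div_succ_le w)
  have h3 : ∀ l : ℕ, ((i : ℕ) + l + 1 - i : ℕ) = l + 1 := fun l => by omega
  simp only [h3, Nat.cast_add, Nat.cast_one]
  refine Finset.sum_le_sum_of_subset_of_nonneg
    (Finset.range_subset_range.2 (Nat.sub_le _ _)) fun l hl _ => Real.log_nonneg ?_
  rw [le_div_iff₀ (by positivity), one_mul]
  exact_mod_cast Finset.mem_range.1 hl

/-- The number of `k`-colorings of the picture `c`. -/
def colorings {w : ℕ} (k : ℕ) (c : Fin w → Fin w → ℕ) : ℕ :=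
  ∏ i : Fin w, ∏ j : Fin w, (if i ≤ j then Nat.choose (c i j + k - 1) (k - 1) else 1)

lemma colorings_pos {w k : ℕ} (hk : 0 < k) (c : Fin w → Fin w → ℕ) : 0 < colorings k c := by
  refine Finset.prod_pos fun i _ => Finset.prod_pos fun j _ => ?_
  split_ifs
  · exact Nat.choose_pos (by omega)
  · exact one_pos

lemma log_colorings {w k : ℕ} (hk : 0 < k) (c : Fin w → Fin w → ℕ) :
    Real.log (colorings k c) = ∑ i : Fin w, ∑ j : Fin w,
      if i ≤ j then Real.log ((c i j + (k - 1)).choose (k - 1) : ℝ) else 0 := by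
  have hne : ∀ i j : Fin w,
      ((if i ≤ j then Nat.choose (c i j + k - 1) (k - 1) else 1 : ℕ) : ℝ) ≠ 0 := by
    intro i j
    split_ifs
    · exact_mod_cast (Nat.choose_pos (by omega)).ne'
    · simp
  unfold colorings
  rw [Nat.cast_prod, Real.log_prod fun i _ => by
    rw [Nat.cast_prod]; exact Finset.prod_ne_zero_iff.2 fun j _ => hne i j]
  refine Finset.sum_congr rfl fun i _ => ?_
  rw [Nat.cast_prod, Real.log_prod fun j _ => hne i j]
  refine Finset.sum_congr rfl fun j _ => ?_
  split_ifs
  · rw [Nat.add_sub_assoc hk]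
  · simp

lemma log_colorings_le {w h k : ℕ} (hw : 0 < w) (hh : 0 < h) (hk : 0 < k)
    (hR : (k : ℝ) * (w : ℝ) ^ 2 ≤ h) {c : Fin w → Fin w → ℕ}
    (hc : IsKostant (fun _ : Fin w => h) c) :
    Real.log (colorings k c) ≤
      k * (w : ℝ) ^ 2 * (3 + Real.log (h / (k * (w : ℝ) ^ 2))) := by
  have hw' : (0 : ℝ) < w := by exact_mod_cast hw
  have hh' : (0 : ℝ) < h := by exact_mod_cast hh
  have hk' : (0 : ℝ) < k := by exact_mod_cast hk
  set R : ℝ := h / (k * (w : ℝ) ^ 2) with hRdef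
  have hR1 : 1 ≤ R := by rwa [hRdef, le_div_iff₀ (by positivity), one_mul]
  have hlogR : 0 ≤ Real.log R := Real.log_nonneg hR1
  have hlog2 : Real.log 2 ≤ 1 := by linarith [Real.log_two_lt_d9]
  have hterm : ∀ i j : Fin w,
      (if i ≤ j then Real.log ((c i j + (k - 1)).choose (k - 1) : ℝ) else 0) ≤
        (k * w / h) * ((c i j * ((j : ℕ) + 1 - i) : ℕ) : ℝ) + k * (1 + Real.log R) +
          k * (if i ≤ j then Real.log ((w : ℝ) / ((j + 1 - i : ℕ) : ℝ)) else 0) := by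
    intro i j
    split_ifs with hij
    · have hij' : (i : ℕ) ≤ j := hij
      have hl1 : (1 : ℝ) ≤ ((j + 1 - i : ℕ) : ℝ) := by exact_mod_cast (by omega)
      have hlw : ((j + 1 - i : ℕ) : ℝ) ≤ w := by
        have := j.2
        exact_mod_cast (by omega)
      push_cast
      set l : ℝ := ((j + 1 - i : ℕ) : ℝ) with hl
      have hl0 : 0 < l := by linarith
      have hs1 : k * w / h * l ≤ 1 := by
        rw [div_mul_eq_mul_div, div_le_one hh']
        refine le_trans ?_ hR
        nlinarith [mul_pos hk' hw']
      have hsplit : Real.log (2 / (k * w / h * l)) =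
          Real.log 2 + Real.log R + Real.log (w / l) := by
        rw [← Real.log_mul (by norm_num) (by positivity), ← Real.log_mul (by positivity)
          (by positivity)]
        congr 1
        rw [hRdef]
        field_simp
      have hnn : 0 ≤ Real.log (w / l) :=
        Real.log_nonneg (by rwa [le_div_iff₀ hl0, one_mul])
      have hmain := log_choose_le (c i j) (k - 1) (s := k * w / h * l) (by positivity) hs1
      have hkk : ((k - 1 : ℕ) : ℝ) ≤ k := by exact_mod_cast Nat.sub_le _ _
      have hlast : ((k - 1 : ℕ) : ℝ) * Real.log (2 / (k * w / h * l)) ≤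
          k * (1 + Real.log R + Real.log (w / l)) := by
        rw [hsplit]
        have : 0 ≤ Real.log 2 := Real.log_nonneg (by norm_num)
        gcongr
      linarith
    · simp only [mul_zero, add_zero]
      positivity
  have hmass : ∑ i : Fin w, ∑ j : Fin w, ((c i j * ((j : ℕ) + 1 - i) : ℕ) : ℝ) = w * h := by
    have := hc.sum_mul_length
    simp only [Finset.sum_const, Finset.card_univ, Fintype.card_fin, smul_eq_mul] at this
    exact_mod_cast this
  rw [log_colorings hk]
  refine (Finset.sum_le_sum fun i _ => Finset.sum_le_sum fun j _ => hterm i j).trans ?_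
  simp only [Finset.sum_add_distrib, ← Finset.mul_sum, hmass, Finset.sum_const, Finset.card_univ,
    Fintype.card_fin, nsmul_eq_mul]
  have hlen : ∑ i : Fin w, ∑ j : Fin w,
      (if i ≤ j then Real.log ((w : ℝ) / ((j + 1 - i : ℕ) : ℝ)) else 0) ≤ w * w := by
    refine (Finset.sum_le_sum fun i _ => sum_log_div_length_le i).trans ?_
    simp
  have hfirst : (k * w / h : ℝ) * (w * h) = k * (w : ℝ) ^ 2 := by
    field_simp
  rw [hfirst]
  nlinarith [mul_le_mul_of_nonneg_left hlen hk'.le]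

/-- A constant height `h ≥ q * w ^ 2` is attained by a picture in which every loop occurs at
least `q` times. -/
lemma exists_isKostant_of_mul_sq_le {w h q : ℕ} (hq : q * w ^ 2 ≤ h) :
    ∃ c : Fin w → Fin w → ℕ, IsKostant (fun _ : Fin w => h) c ∧ ∀ i j, i ≤ j → q ≤ c i j := by
  classical
  let A : Fin w → ℕ := fun m => ∑ i : Fin w, ∑ j : Fin w, if i ≤ m ∧ m ≤ j then q else 0
  have hA : ∀ m, A m ≤ h := by
    intro m
    calc A m ≤ ∑ i : Fin w, ∑ j : Fin w, q :=
          Finset.sum_le_sum fun i _ => Finset.sum_le_sum fun j _ => by split_ifs <;> simp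
      _ = q * w ^ 2 := by simp; ring
      _ ≤ h := hq
  refine ⟨fun i j => (if i ≤ j then q else 0) + if i = j then h - A i else 0,
    ⟨fun i j hji => ?_, fun m => ?_⟩, fun i j hij => by simp [hij]⟩
  · simp [not_le.2 hji, hji.ne']
  · have hsplit : ∀ i j : Fin w, (if i ≤ m ∧ m ≤ j then
        ((if i ≤ j then q else 0) + if i = j then h - A i else 0) else 0) =
        (if i ≤ m ∧ m ≤ j then q else 0) +
          if i = m then (if j = m then h - A m else 0) else 0 := by
      intro i j
      by_cases hm : i ≤ m ∧ m ≤ j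
      · simp only [hm, and_self, if_true, hm.1.trans hm.2]
        by_cases hij : i = j
        · subst hij
          obtain rfl := le_antisymm hm.1 hm.2
          simp
        · have : ¬ (i = m ∧ j = m) := fun h' => hij (h'.1.trans h'.2.symm)
          simp only [hij, if_false]
          rw [← ite_and, if_neg this]
      · have : ¬ (i = m ∧ j = m) := fun h' => hm ⟨h'.1.le, h'.2.ge⟩
        rw [if_neg hm, if_neg hm, ← ite_and, if_neg this]
    simp only [hsplit, Finset.sum_add_distrib]
    have : A m + (h - A m) = h := Nat.add_sub_cancel' (hA m)
    simpa [A] using this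

lemma pow_le_pow_mul_choose (q r : ℕ) : (q + r) ^ r ≤ r ^ r * (q + r).choose r := by
  have key : ∀ m ≤ r, (q + r) ^ m * r.descFactorial m ≤ r ^ m * (q + r).descFactorial m := by
    intro m
    induction m with
    | zero => simp
    | succ m ih =>
      intro hm
      have h1 := ih (by omega)
      have h2 : (q + r) * (r - m) ≤ r * (q + r - m) := by
        obtain ⟨d, rfl⟩ : ∃ d, r = m + d := ⟨r - m, by omega⟩
        have e1 : m + d - m = d := by omega
        have e2 : q + (m + d) - m = q + d := by omega
        rw [e1, e2]
        nlinarith [Nat.zero_le (q * m)]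
      rw [Nat.descFactorial_succ, Nat.descFactorial_succ, pow_succ, pow_succ]
      calc _ = ((q + r) * (r - m)) * ((q + r) ^ m * r.descFactorial m) := by ring
        _ ≤ (r * (q + r - m)) * (r ^ m * (q + r).descFactorial m) := Nat.mul_le_mul h2 h1
        _ = _ := by ring
  have h := key r le_rfl
  rw [Nat.descFactorial_self, Nat.descFactorial_eq_factorial_mul_choose] at h
  refine Nat.le_of_mul_le_mul_left ?_ r.factorial_pos
  linarith

lemma mul_log_le_log_choose {q r : ℕ} (hr : 0 < r) :
    r * Real.log ((q + r : ℝ) / r) ≤ Real.log ((q + r).choose r : ℝ) := by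
  have hr' : (0 : ℝ) < r := by exact_mod_cast hr
  rw [← Real.log_pow, div_pow]
  refine Real.log_le_log (by positivity) ?_
  rw [div_le_iff₀ (by positivity), mul_comm]
  exact_mod_cast pow_le_pow_mul_choose q r

lemma half_sq_le_sum_le (w : ℕ) :
    (w : ℝ) ^ 2 / 2 ≤ ∑ i : Fin w, ∑ j : Fin w, if i ≤ j then (1 : ℝ) else 0 := by
  have hswap : ∑ i : Fin w, ∑ j : Fin w, (if i ≤ j then (1 : ℝ) else 0) =
      ∑ i : Fin w, ∑ j : Fin w, if j ≤ i then (1 : ℝ) else 0 := Finset.sum_comm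
  have hsum : (w : ℝ) ^ 2 ≤ ∑ i : Fin w, ∑ j : Fin w, (if i ≤ j then (1 : ℝ) else 0) +
      ∑ i : Fin w, ∑ j : Fin w, if j ≤ i then (1 : ℝ) else 0 := by
    simp only [← Finset.sum_add_distrib]
    calc (w : ℝ) ^ 2 = ∑ i : Fin w, ∑ j : Fin w, (1 : ℝ) := by simp; ring
      _ ≤ _ := Finset.sum_le_sum fun i _ => Finset.sum_le_sum fun j _ => by
        rcases le_total i j with hij | hij <;> simp only [hij, if_true] <;> split_ifs <;> norm_num
  linarith

lemma le_log_colorings {w h k q : ℕ} (hw : 0 < w) (hk : 2 ≤ k)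
    (hR : (k : ℝ) * (w : ℝ) ^ 2 ≤ h) (hq : h < (q + 1) * w ^ 2) {c : Fin w → Fin w → ℕ}
    (hc : ∀ i j, i ≤ j → q ≤ c i j) :
    1 / 4 * (k * (w : ℝ) ^ 2 * Real.log (h / (k * (w : ℝ) ^ 2))) ≤
      Real.log (colorings k c) := by
  have hw' : (0 : ℝ) < w := by exact_mod_cast hw
  have hk' : (2 : ℝ) ≤ k := by exact_mod_cast hk
  set R : ℝ := h / (k * (w : ℝ) ^ 2) with hRdef
  have hR1 : 1 ≤ R := by rwa [hRdef, le_div_iff₀ (by positivity), one_mul]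
  have hlogR : 0 ≤ Real.log R := Real.log_nonneg hR1
  have hkc : ((k - 1 : ℕ) : ℝ) = k - 1 := by push_cast [Nat.cast_sub (by omega : 1 ≤ k)]; rfl
  have hchoose : ((k : ℝ) / 2) * Real.log R ≤ Real.log ((q + (k - 1)).choose (k - 1) : ℝ) := by
    refine le_trans ?_ (mul_log_le_log_choose (by omega))
    rw [hkc]
    have hRle : R ≤ (q + (k - 1 : ℝ)) / (k - 1) := by
      have hq' : (h : ℝ) ≤ (q + 1) * (w : ℝ) ^ 2 := by exact_mod_cast hq.le
      rw [hRdef, div_le_div_iff₀ (by positivity) (by linarith)]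
      have h1 : (h : ℝ) * (k - 1) ≤ (q + 1) * (w : ℝ) ^ 2 * (k - 1) :=
        mul_le_mul_of_nonneg_right hq' (by linarith)
      have h2 : ((q : ℝ) + 1) * (k - 1) ≤ (q + (k - 1)) * k := by
        nlinarith [(Nat.cast_nonneg q : (0 : ℝ) ≤ q)]
      nlinarith [mul_le_mul_of_nonneg_left h2 (sq_nonneg (w : ℝ))]
    have hk2 : (k : ℝ) / 2 ≤ k - 1 := by linarith
    have hk3 : (0 : ℝ) ≤ k - 1 := by linarith
    gcongr
  rw [log_colorings (by omega)]
  calc 1 / 4 * (k * (w : ℝ) ^ 2 * Real.log R)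
      = (w : ℝ) ^ 2 / 2 * (((k : ℝ) / 2) * Real.log R) := by ring
    _ ≤ (∑ i : Fin w, ∑ j : Fin w, if i ≤ j then (1 : ℝ) else 0) *
        (((k : ℝ) / 2) * Real.log R) :=
      mul_le_mul_of_nonneg_right (half_sq_le_sum_le w) (by positivity)
    _ ≤ _ := by
      simp only [Finset.sum_mul]
      refine Finset.sum_le_sum fun i _ => Finset.sum_le_sum fun j _ => ?_
      split_ifs with hij
      · rw [one_mul]
        refine hchoose.trans (Real.log_le_log ?_ ?_)
        · exact_mod_cast Nat.choose_pos (by omega)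
        · exact_mod_cast Nat.choose_le_choose _ (Nat.add_le_add_right (hc i j hij) _)
      · simp

lemma Lcol_bounds {w h k : ℕ} (hw : 0 < w) (hh : 0 < h) (hk : 2 ≤ k)
    (hR : (k : ℝ) * (w : ℝ) ^ 2 ≤ h) :
    1 / 4 * (k * (w : ℝ) ^ 2 * Real.log (h / (k * (w : ℝ) ^ 2))) ≤ Lcol k h w ∧
      Lcol k h w ≤ k * (w : ℝ) ^ 2 * (3 + Real.log (h / (k * (w : ℝ) ^ 2))) := by
  have hk0 : 0 < k := by omega
  have hT : Tcol k (fun _ : Fin w => h) =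
    sSup (colorings k '' {c : Fin w → Fin w → ℕ | IsKostant (fun _ => h) c}) := rfl
  have hbdd : BddAbove (colorings k '' {c : Fin w → Fin w → ℕ | IsKostant (fun _ => h) c}) := by
    refine ⟨⌊Real.exp (k * (w : ℝ) ^ 2 * (3 + Real.log (h / (k * (w : ℝ) ^ 2))))⌋₊, ?_⟩
    rintro _ ⟨c, hc, rfl⟩
    refine Nat.le_floor ?_
    rw [← Real.log_le_iff_le_exp (by exact_mod_cast colorings_pos hk0 c)]
    exact log_colorings_le hw hh hk0 hR hc
  obtain ⟨c, hc, hcq⟩ := exists_isKostant_of_mul_sq_le (Nat.div_mul_le_self h (w ^ 2))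
  have hmem : colorings k c ∈
    colorings k '' {c : Fin w → Fin w → ℕ | IsKostant (fun _ => h) c} := ⟨c, hc, rfl⟩
  unfold Lcol
  constructor
  · refine (le_log_colorings hw hk hR (Nat.lt_mul_of_div_lt (Nat.lt_succ_self _) (by positivity)) hcq).trans ?_
    refine Real.log_le_log (by exact_mod_cast colorings_pos hk0 c) ?_
    rw [hT]
    exact_mod_cast le_csSup hbdd hmem
  · obtain ⟨d, hd, hdT⟩ := Nat.sSup_mem ⟨_, hmem⟩ hbdd
    rw [hT, ← hdT]
    exact log_colorings_le hw hh hk0 hR hd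

/-- If `k ≻ 1` and `h ≻ k·w²`, then `L^k[h,w] ≍ k·w²·ln(h/(k·w²))`. -/
theorem Lcol_asymp_large (h w k : ℕ → ℕ)
    (hh : ∀ n, 0 < h n) (hw : ∀ n, 0 < w n) (hk : ∀ n, 0 < k n)
    (hk1 : Tendsto (fun n => (1 : ℝ) / k n) atTop (nhds 0))
    (hbig : Tendsto (fun n => ((k n : ℝ) * (w n : ℝ) ^ 2) / (h n : ℝ)) atTop (nhds 0)) :
    ∃ a b : ℝ, 0 < a ∧ a ≤ b ∧ ∀ᶠ n : ℕ in atTop,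
      a * ((k n : ℝ) * (w n : ℝ) ^ 2 *
          Real.log ((h n : ℝ) / ((k n : ℝ) * (w n : ℝ) ^ 2))) ≤ Lcol (k n) (h n) (w n) ∧
      Lcol (k n) (h n) (w n) ≤
        b * ((k n : ℝ) * (w n : ℝ) ^ 2 *
          Real.log ((h n : ℝ) / ((k n : ℝ) * (w n : ℝ) ^ 2))) := by
  have hK : ∀ᶠ n in atTop, (1 : ℝ) / k n < 1 := hk1.eventually (gt_mem_nhds one_pos)
  have hB : ∀ᶠ n in atTop, ((k n : ℝ) * (w n : ℝ) ^ 2) / (h n : ℝ) < Real.exp (-1) :=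
    hbig.eventually (gt_mem_nhds (Real.exp_pos _))
  refine ⟨1 / 4, 4, by norm_num, by norm_num, ?_⟩
  filter_upwards [hK, hB] with n hKn hBn
  have hw' : (0 : ℝ) < w n := by exact_mod_cast hw n
  have hh' : (0 : ℝ) < h n := by exact_mod_cast hh n
  have hk' : (0 : ℝ) < k n := by exact_mod_cast hk n
  have hk2 : 2 ≤ k n := by
    rw [div_lt_one hk'] at hKn
    exact_mod_cast hKn
  have hR : (k n : ℝ) * (w n : ℝ) ^ 2 ≤ h n := by
    rw [← div_le_one hh']
    exact hBn.le.trans (Real.exp_le_one_iff.2 (by norm_num))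
  have hlog : 1 ≤ Real.log ((h n : ℝ) / ((k n : ℝ) * (w n : ℝ) ^ 2)) := by
    have := (Real.log_lt_iff_lt_exp (by positivity)).2 hBn
    rw [← inv_div, Real.log_inv]
    linarith
  obtain ⟨h1, h2⟩ := Lcol_bounds (hw n) (hh n) hk2 hR
  refine ⟨h1, h2.trans ?_⟩
  rw [mul_left_comm]
  gcongr
  linarith
end
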